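/- Let F ∈ ℤ[x₁,…,xₙ] be a form of degree d ≥ 3 with singular locus over ℚ of dimension σ, and assume n − σ > (3/4)·(d−1)·2^d. Fix x₀ ∈ ℝⁿ with F(x₀) = 0 and ∇F(x₀) ≠ 0, and let ω be the weight described in the context, for δ ∈ (0, 1] sufficiently small. Then: (i) the singular series 𝔖 := lim_{R→∞} 𝔖(R) and the singular integral 𝔍 := lim_{R→∞} 𝔍(R) exist (the defining series and integral converge absolutely); and (ii) taking Δ = 1/6 in the definition of the major arcs 𝔐, there exists δ' > 0 such that ∫_𝔐 S(α, P) dα = 𝔖·𝔍·P^{n−d} + O(P^{n−d−δ'}) as P → ∞. -/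

import Mathlib

noncomputable section
open scoped Classical
open MvPolynomial MeasureTheory

/-- Distance from a real number to the nearest integer. -/
def nint (x : ℝ) : ℝ := |x - round x|

/-- `α ∈ 𝕋` and `q ∈ ℕ` are *primitive* if there is `a` coprime to `q`
with `‖qα‖ = |qα - a|`. -/
def Primitive (α : ℝ) (q : ℕ) : Prop :=
  ∃ a : ℤ, Int.gcd a q = 1 ∧ nint (q * α) = |q * α - a|

/-- `e(t) = exp(2πit)`. -/
def eC (t : ℝ) : ℂ := Complex.exp (2 * Real.pi * Complex.I * t)

/-- The exponential sum `S(α, P) = Σ_{x ∈ ℤⁿ} ω(x/P) e(α f(x))`. -/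
def expSum (n : ℕ) (f : MvPolynomial (Fin n) ℤ) (ω : (Fin n → ℝ) → ℝ) (α P : ℝ) : ℂ :=
  ∑' x : Fin n → ℤ, (ω (fun i => (x i : ℝ) / P) : ℂ) * eC (α * (MvPolynomial.eval x f : ℝ))

/-- Mixed partial derivative `∂^ε g`. -/
def mpderiv (n : ℕ) (ε : Fin n → ℕ) (g : (Fin n → ℝ) → ℝ) : (Fin n → ℝ) → ℝ :=
  (List.finRange n).foldr
    (fun i h => (fun u : (Fin n → ℝ) → ℝ => fun x => fderiv ℝ u x (Pi.single i 1))^[ε i] h) g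

/-- A super-exponential increasing tuple of positive constants `(c, c₀, c₁, …)`. -/
def SuperSeq (c : ℝ) (cs : ℕ → ℝ) : Prop :=
  0 < c ∧ c ≤ cs 0 ∧ Monotone cs ∧ ∀ i j, cs i * cs j ≤ cs (i + j)

/-- Membership of `ω` in the class `𝒮⁺(𝐜)` of smooth weight functions. -/
def SmoothWeight (n : ℕ) (c : ℝ) (cs : ℕ → ℝ) (ω : (Fin n → ℝ) → ℝ) : Prop :=
  ContDiff ℝ (⊤ : ℕ∞) ω ∧ (∀ x, 0 ≤ ω x) ∧ (∀ x, ω x ≠ 0 → ∀ i, |x i| ≤ c) ∧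
    ∀ (ε : Fin n → ℕ) (x : Fin n → ℝ), |mpderiv n ε ω x| ≤ cs (∑ i, ε i)

/-- Dimension of the singular locus of `g` over `K`, i.e. the Krull dimension
of the coordinate ring of the affine set cut out by `∇g = 0`. -/
def singDim (n : ℕ) (K : Type) [CommRing K] (g : MvPolynomial (Fin n) K) : WithBot (WithTop ℕ) :=
  ringKrullDim (MvPolynomial (Fin n) K ⧸ Ideal.span (Set.range fun i => MvPolynomial.pderiv i g))

/-- `Height f ≤ H`: all coefficients of `f` are at most `H` in absolute value. -/
def HeightLe (n : ℕ) (f : MvPolynomial (Fin n) ℤ) (H : ℝ) : Prop :=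
  ∀ m : Fin n →₀ ℕ, |((f.coeff m : ℤ) : ℝ)| ≤ H

/-- `Height_{P,k} f ≤ H`: the relative height of `f` w.r.t. `P` at scale `k` is at most `H`. -/
def HeightPLe (n k : ℕ) (P : ℝ) (f : MvPolynomial (Fin n) ℤ) (H : ℝ) : Prop :=
  ∀ m : Fin n →₀ ℕ, |((f.coeff m : ℤ) : ℝ)| * P ^ (m.sum fun _ e => e) ≤ H * P ^ k

/-- `b = ∏_{p^e ∥ q, e ≤ 2} p^e`. -/
def bOf (q : ℕ) : ℕ :=
  ∏ p ∈ q.primeFactors, if q.factorization p ≤ 2 then p ^ q.factorization p else 1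

/-- `c₁ = ∏_{p^e ∥ q, e > 2} p^⌊e/2⌋`. -/
def c1Of (q : ℕ) : ℕ :=
  ∏ p ∈ q.primeFactors, if 2 < q.factorization p then p ^ (q.factorization p / 2) else 1

/-- `c₂ = ∏_{p^e ∥ q, e > 2, e odd} p`. -/
def c2Of (q : ℕ) : ℕ :=
  ∏ p ∈ q.primeFactors, if 2 < q.factorization p ∧ Odd (q.factorization p) then p else 1

/-- `η_q = max{(b³c₁c₂²)^{1/(2^d−2)}, (b³c₁²c₂)^{1/(5·2^{d−2}−4)}}`. -/
def etaOf (d q : ℕ) : ℝ :=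
  max (((bOf q : ℝ) ^ 3 * (c1Of q : ℝ) * (c2Of q : ℝ) ^ 2) ^ ((1 : ℝ) / ((2:ℝ) ^ (d : ℝ) - 2)))
      (((bOf q : ℝ) ^ 3 * (c1Of q : ℝ) ^ 2 * (c2Of q : ℝ)) ^
        ((1 : ℝ) / (5 * (2:ℝ) ^ ((d : ℝ) - 2) - 4)))

/-- The `r`-values `r_i = ∏_{p^e ∥ kb, σ_p(g^{[k]}) = i} p^e` of `g` w.r.t. `q`. -/
def rOf (n k q : ℕ) (g : MvPolynomial (Fin n) ℤ) (i : ℕ) : ℕ :=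
  ∏ p ∈ (k * bOf q).primeFactors,
    if singDim n (ZMod p)
        (MvPolynomial.map (Int.castRingHom (ZMod p)) (MvPolynomial.homogeneousComponent k g))
        = (i : WithBot (WithTop ℕ))
    then p ^ ((k * bOf q).factorization p) else 1

/-- `R^{[k]}_ζ(g, q) = ∏_{ζ ≤ i ≤ n} r_i^{i−ζ}`. -/
def ROf (n k q : ℕ) (g : MvPolynomial (Fin n) ℤ) (ζ : ℕ) : ℕ :=
  ∏ i ∈ Finset.Icc ζ n, (rOf n k q g i) ^ (i - ζ)

/-- `ξ = (5 − 2^{4−d})/(3 − 2^{3−d})`. -/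
def xiOf (d : ℕ) : ℝ := (5 - (2:ℝ) ^ ((4 : ℝ) - d)) / (3 - (2:ℝ) ^ ((3 : ℝ) - d))

/-- `γ = 1/(3·2^{d−2} − 2)`. -/
def gamOf (d : ℕ) : ℝ := 1 / (3 * (2:ℝ) ^ ((d : ℝ) - 2) - 2)

/-- `A_d = 7·2^{d−4} − 5/4`. -/
def AdOf (d : ℕ) : ℝ := 7 * (2:ℝ) ^ ((d : ℝ) - 4) - 5 / 4

/-- `B_k = (k−1)·2^{d−1}`. -/
def BkOf (d k : ℕ) : ℝ := ((k : ℝ) - 1) * (2:ℝ) ^ ((d : ℝ) - 1)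

/-- `V_k = 2^{d+1−k} − 2`. -/
def VkOf (d k : ℕ) : ℝ := (2:ℝ) ^ ((d : ℝ) + 1 - (k : ℝ)) - 2

/-- `C(α, q) = (‖qα‖P)^{1/(2^{d−1}−2)} + (qP^{−2})^{1/2^{d−2}} + η_q⁻¹`. -/
def CCof (d : ℕ) (P : ℝ) (q : ℕ) (α : ℝ) : ℝ :=
  (nint (q * α) * P) ^ (1 / ((2:ℝ) ^ ((d : ℝ) - 1) - 2)) +
    ((q : ℝ) * P ^ (-(2 : ℝ))) ^ (1 / (2:ℝ) ^ ((d : ℝ) - 2)) + (etaOf d q)⁻¹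

/-- `W_k(α, q)`; the term `(‖qα‖P^k)^{−1/B_k}` is interpreted as `+∞` when `‖qα‖ = 0`. -/
def WWof (d k : ℕ) (P : ℝ) (q : ℕ) (α : ℝ) : ℝ :=
  P ^ (-((2:ℝ) ^ (1 - (d : ℝ)))) + nint (q * α) ^ (1 / (BkOf d k + VkOf d k)) +
    ((q : ℝ) * P ^ (-(k : ℝ))) ^ (1 / BkOf d k) +
    min ((q : ℝ) ^ (-(1 / (BkOf d k + VkOf d k))))
      (if nint (q * α) = 0 then (q : ℝ) ^ (-(1 / (BkOf d k + VkOf d k)))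
       else (nint (q * α) * P ^ (k : ℝ)) ^ (-(1 / BkOf d k)))

/-- `M(α, q) = min{C(α, q), W₃(α, q), …, W_d(α, q)}`. -/
def MMof (d : ℕ) (P : ℝ) (q : ℕ) (α : ℝ) : ℝ :=
  min (CCof d P q α) (sInf ((fun k => WWof d k P q α) '' Set.Icc 3 d))

/-- `W_k*(α, q)`; the term `(‖qα‖P^k)^{−1/B_k}` is interpreted as `+∞` when `‖qα‖ = 0`. -/
def WSof (d k : ℕ) (P : ℝ) (q : ℕ) (α : ℝ) : ℝ :=
  max (nint (q * α) ^ (1 / (BkOf d k + VkOf d k)))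
    (min ((etaOf d q)⁻¹)
      (if nint (q * α) = 0 then (etaOf d q)⁻¹
       else (nint (q * α) * P ^ (k : ℝ)) ^ (-(1 / BkOf d k))))

/-- `M*(α, q) = min{W₃*(α, q), …, W_d*(α, q)}`. -/
def MSof (d : ℕ) (P : ℝ) (q : ℕ) (α : ℝ) : ℝ :=
  sInf ((fun k => WSof d k P q α) '' Set.Icc 3 d)

/-- The major arcs `𝔐(Δ)`, viewed inside a fundamental domain `[0,1)` for `𝕋 = ℝ/ℤ`. -/
def majorArcs (d : ℕ) (Δ P : ℝ) : Set ℝ :=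
  {α | ∃ q : ℕ, 0 < q ∧ (q : ℝ) ≤ P ^ Δ ∧
    ∃ a : ℕ, a ≤ q ∧ Nat.gcd a q = 1 ∧ nint (α - (a : ℝ) / q) ≤ P ^ (Δ - d)}

/-- The minor arcs `𝔪 = 𝕋 ∖ 𝔐(Δ)`. -/
def minorArcs (d : ℕ) (Δ P : ℝ) : Set ℝ := Set.Ico (0 : ℝ) 1 \ majorArcs d Δ P



/-- The bump function `w`. -/
def wBump (x : ℝ) : ℝ := if |x| < 1 then Real.exp (-(1 - x ^ 2)⁻¹) else 0

/-- The weight `ω(x) = w(δ⁻¹‖x − x₀‖₂)`. -/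
def omegaMaj (n : ℕ) (x₀ : Fin n → ℝ) (δ : ℝ) (x : Fin n → ℝ) : ℝ :=
  wBump (δ⁻¹ * Real.sqrt (∑ i, (x i - x₀ i) ^ 2))

/-- The complete exponential sum `S_q(a) = Σ_{y mod q} e_q(a F(y))`. -/
def gaussSumF (n : ℕ) (F : MvPolynomial (Fin n) ℤ) (q a : ℕ) : ℂ :=
  ∑ y ∈ Finset.Icc (0 : Fin n → ℤ) (fun _ => (q : ℤ) - 1),
    eC ((a : ℝ) * (MvPolynomial.eval y F : ℝ) / q)

/-- The summand `A(q) = q^{−n} Σ_{a mod q, (a,q)=1} S_q(a)` of the singular series. -/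
def seriesTerm (n : ℕ) (F : MvPolynomial (Fin n) ℤ) (q : ℕ) : ℂ :=
  if q = 0 then 0
  else ((q : ℂ) ^ n)⁻¹ *
    ∑ a ∈ (Finset.Icc 1 q).filter (fun a => Nat.gcd a q = 1), gaussSumF n F q a

/-- The inner integral `I(γ) = ∫_{ℝⁿ} ω(x) e(γF(x)) dx` of the singular integral. -/
def singInt (n : ℕ) (F : MvPolynomial (Fin n) ℤ) (ω : (Fin n → ℝ) → ℝ) (γ : ℝ) : ℂ :=
  ∫ x : Fin n → ℝ,
    (ω x : ℂ) * eC (γ * MvPolynomial.eval x (MvPolynomial.map (Int.castRingHom ℝ) F))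


section LinearForms

attribute [local instance] MvPolynomial.gradedAlgebra

variable {ι k : Type*} [Field k]

/-- The linear form with coefficient vector `a`. -/
def linForm [Fintype ι] {R : Type*} [CommRing R] (a : ι → R) : MvPolynomial ι R := ∑ i, C (a i) * X i

theorem linForm_isHomogeneous [Fintype ι] {R : Type*} [CommRing R] (a : ι → R) :
    (linForm a).IsHomogeneous 1 := by
  refine IsHomogeneous.sum _ _ _ fun i _ => ?_
  simpa using (isHomogeneous_C ι (a i)).mul (isHomogeneous_X R i)

theorem isHomogeneous_of_mem_minimalPrimes {I P : Ideal (MvPolynomial ι k)}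
    (hI : I.IsHomogeneous (homogeneousSubmodule ι k)) (hP : P ∈ I.minimalPrimes) :
    P.IsHomogeneous (homogeneousSubmodule ι k) := by
  rw [Ideal.IsHomogeneous.iff_eq]
  refine le_antisymm (Ideal.toIdeal_homogeneousCore_le _ _) (hP.2 ⟨?_, ?_⟩ ?_)
  · exact Ideal.IsPrime.homogeneousCore hP.1.1
  · rw [← hI.toIdeal_homogeneousCore_eq_self]
    exact Ideal.homogeneousCore_mono _ hP.1.2
  · exact Ideal.toIdeal_homogeneousCore_le _ _

theorem le_ker_constantCoeff {P : Ideal (MvPolynomial ι k)} (hP : P ≠ ⊤)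
    (h : P.IsHomogeneous (homogeneousSubmodule ι k)) :
    P ≤ RingHom.ker (constantCoeff : MvPolynomial ι k →+* k) := by
  intro f hf
  have h0 := (mem_iff_homogeneousComponent_mem h f).1 hf 0
  rw [homogeneousComponent_zero] at h0
  by_contra hc
  apply hP
  apply Ideal.eq_top_of_isUnit_mem _ h0
  rw [RingHom.mem_ker, constantCoeff_eq] at hc
  exact (IsUnit.mk0 _ hc).map C

theorem ker_constantCoeff_le {P : Ideal (MvPolynomial ι k)} (h : ∀ i, X i ∈ P) :
    RingHom.ker (constantCoeff : MvPolynomial ι k →+* k) ≤ P := by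
  intro f hf
  rw [f.as_sum]
  refine Ideal.sum_mem _ fun m hm => ?_
  have hm0 : m ≠ 0 := by
    rintro rfl
    rw [RingHom.mem_ker, constantCoeff_eq] at hf
    exact (mem_support_iff.1 hm) hf
  obtain ⟨i, hi⟩ := Finsupp.ne_iff.1 hm0
  have : monomial m (coeff m f) = monomial (m - Finsupp.single i 1) (coeff m f) * X i := by
    rw [X, monomial_mul, mul_one, tsub_add_cancel_of_le]
    simpa [Finsupp.single_le_iff, Nat.one_le_iff_ne_zero] using hi
  rw [this]
  exact Ideal.mul_mem_left _ _ (h i)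

theorem ker_constantCoeff_isMaximal :
    (RingHom.ker (constantCoeff : MvPolynomial ι k →+* k)).IsMaximal :=
  RingHom.ker_isMaximal_of_surjective _ fun c => ⟨C c, by simp⟩

theorem linForm_add [Fintype ι] (a b : ι → k) : linForm (a + b) = linForm a + linForm b := by
  simp [linForm, add_mul, Finset.sum_add_distrib]

theorem linForm_smul [Fintype ι] (c : k) (a : ι → k) : linForm (c • a) = C c * linForm a := by
  simp [linForm, Finset.mul_sum, mul_assoc]

theorem linForm_single [Fintype ι] (i : ι) : linForm (Pi.single i 1 : ι → k) = X i := by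
  rw [linForm, Finset.sum_eq_single i] <;> simp +contextual

theorem exists_linForm_notMem [Fintype ι] [Infinite k] {I : Ideal (MvPolynomial ι k)} :
    ∃ a : ι → k, ∀ P ∈ I.minimalPrimes, linForm a ∈ P → ∀ i, X i ∈ P := by
  let V : Ideal (MvPolynomial ι k) → Submodule k (ι → k) := fun P =>
    { carrier := {a | linForm a ∈ P}
      add_mem' := fun {a b} ha hb => by
        simpa [linForm_add] using P.add_mem ha hb
      zero_mem' := by simp [linForm]
      smul_mem' := fun c a ha => by
        simpa [linForm_smul] using P.mul_mem_left _ ha }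
  have hfin : I.minimalPrimes.Finite := Ideal.finite_minimalPrimes_of_isNoetherianRing _ I
  let s : Finset (Submodule k (ι → k)) := (hfin.toFinset.image V).erase ⊤
  have hs := Subspace.biUnion_ne_univ_of_top_notMem (s := s) (by simp [s])
  obtain ⟨a, ha⟩ := (Set.ne_univ_iff_exists_notMem _).1 hs
  refine ⟨a, fun P hP haP i => ?_⟩
  have htop : V P = ⊤ := by
    by_contra hne
    exact ha (Set.mem_biUnion (x := V P) (by simp [s, hne]; exact ⟨P, hP, rfl⟩) haP)
  have : Pi.single i 1 ∈ V P := by rw [htop]; trivial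
  change linForm _ ∈ P at this
  rwa [linForm_single] at this

theorem krullDim_zeroLocus_sup_le [Fintype ι] {I : Ideal (MvPolynomial ι k)} {s : ℕ}
    (hI : I.IsHomogeneous (homogeneousSubmodule ι k))
    (hdim : Order.krullDim (PrimeSpectrum.zeroLocus (I : Set (MvPolynomial ι k))) ≤ (s + 1 : ℕ))
    {a : ι → k} (ha : ∀ P ∈ I.minimalPrimes, linForm a ∈ P → ∀ i, X i ∈ P) :
    Order.krullDim (PrimeSpectrum.zeroLocus
      ((I ⊔ Ideal.span {linForm a} : Ideal (MvPolynomial ι k)) : Set (MvPolynomial ι k))) ≤ s := by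
  refine iSup_le fun p => ?_
  have hsub : PrimeSpectrum.zeroLocus
      ((I ⊔ Ideal.span {linForm a} : Ideal (MvPolynomial ι k)) : Set (MvPolynomial ι k)) ⊆
      PrimeSpectrum.zeroLocus (I : Set (MvPolynomial ι k)) :=
    PrimeSpectrum.zeroLocus_anti_mono (SetLike.coe_subset_coe.2 le_sup_left)
  have hh : I ⊔ Ideal.span {linForm a} ≤ p.head.1.asIdeal := p.head.2
  obtain ⟨P, hP, hPle⟩ := Ideal.exists_minimalPrimes_le (le_sup_left.trans hh)
  have hPprime : P.IsPrime := hP.1.1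
  by_cases hcase : linForm a ∈ P
  · have hm := ker_constantCoeff_le (ha P hP hcase)
    have hPm : P.IsMaximal := by
      have := le_antisymm hm
        (le_ker_constantCoeff hPprime.ne_top (isHomogeneous_of_mem_minimalPrimes hI hP))
      rw [← this]; exact ker_constantCoeff_isMaximal
    have h0 : p.length = 0 := by
      by_contra hne
      have hlt : p ⟨0, by omega⟩ < p ⟨1, by omega⟩ := p.strictMono (by simp [Fin.lt_def])
      have h1 : P < (p ⟨1, by omega⟩).1.asIdeal := lt_of_le_of_lt hPle hlt
      exact (p ⟨1, by omega⟩).1.isPrime.ne_top (hPm.1.2 _ h1)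
    rw [h0]; exact_mod_cast Nat.zero_le s
  · have hlt : P < p.head.1.asIdeal := lt_of_le_of_ne hPle fun h => hcase <| by
      rw [h]; exact hh (Ideal.mem_sup_right (Ideal.mem_span_singleton_self _))
    let f : PrimeSpectrum.zeroLocus
      ((I ⊔ Ideal.span {linForm a} : Ideal (MvPolynomial ι k)) : Set (MvPolynomial ι k)) →
      PrimeSpectrum.zeroLocus (I : Set (MvPolynomial ι k)) := Set.inclusion hsub
    let p' := p.map f (fun _ _ h => h)
    let x : PrimeSpectrum.zeroLocus (I : Set (MvPolynomial ι k)) := ⟨⟨P, hPprime⟩, hP.1.2⟩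
    have := (Order.LTSeries.length_le_krullDim (p'.cons x (by exact hlt))).trans hdim
    have h2 : (p'.cons x (by exact hlt)).length = p.length + 1 := by
      change 0 + p.length + 1 = p.length + 1
      rw [zero_add]
    rw [h2] at this
    have h3 : p.length + 1 ≤ s + 1 := by exact_mod_cast this
    exact_mod_cast Nat.le_of_succ_le_succ h3

/-- A cone of dimension at most `s` meets some linear space of codimension `s` only in the
origin. -/
theorem exists_linForms_radical [Fintype ι] [Infinite k] (s : ℕ) :
    ∀ I : Ideal (MvPolynomial ι k), I.IsHomogeneous (homogeneousSubmodule ι k) →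
    Order.krullDim (PrimeSpectrum.zeroLocus (I : Set (MvPolynomial ι k))) ≤ s →
    ∃ a : Fin s → ι → k,
      ∀ i, X i ∈ (I ⊔ Ideal.span (Set.range fun t => linForm (a t))).radical := by
  induction s with
  | zero =>
    intro I hI hdim
    refine ⟨fun t => t.elim0, fun i => ?_⟩
    refine Ideal.radical_mono le_sup_left ?_
    rw [← Ideal.sInf_minimalPrimes, Ideal.mem_sInf]
    intro P hP
    have hPprime : P.IsPrime := hP.1.1
    have hle := le_ker_constantCoeff hPprime.ne_top (isHomogeneous_of_mem_minimalPrimes hI hP)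
    suffices P = RingHom.ker (constantCoeff : MvPolynomial ι k →+* k) by
      rw [this, RingHom.mem_ker]; simp
    by_contra hne
    have hlt := lt_of_le_of_ne hle hne
    have hone : (1 : WithBot ℕ∞) ≤ Order.krullDim
        (PrimeSpectrum.zeroLocus (I : Set (MvPolynomial ι k))) := by
      rw [Order.one_le_krullDim_iff]
      exact ⟨⟨⟨P, hPprime⟩, hP.1.2⟩,
        ⟨⟨_, (ker_constantCoeff_isMaximal (ι := ι) (k := k)).isPrime⟩, hP.1.2.trans hle⟩, hlt⟩
    have := hone.trans hdim
    norm_num at this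
  | succ s ih =>
    intro I hI hdim
    obtain ⟨a, ha⟩ := exists_linForm_notMem (I := I)
    have hspan : (Ideal.span {linForm a}).IsHomogeneous (homogeneousSubmodule ι k) := by
      refine Ideal.homogeneous_span _ _ ?_
      rintro _ rfl
      exact ⟨1, linForm_isHomogeneous a⟩
    obtain ⟨b, hb⟩ := ih _ (hI.sup hspan) (krullDim_zeroLocus_sup_le hI hdim ha)
    refine ⟨Fin.cons a b, fun i => Ideal.radical_mono ?_ (hb i)⟩
    refine sup_le (sup_le le_sup_left ?_) ?_
    · refine le_sup_of_le_right (Ideal.span_mono ?_)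
      rintro _ rfl
      exact ⟨0, by simp⟩
    · refine le_sup_of_le_right (Ideal.span_mono ?_)
      rintro _ ⟨t, rfl⟩
      exact ⟨t.succ, by simp⟩

end LinearForms

section Integrality

attribute [local instance] MvPolynomial.gradedAlgebra

variable {ι k : Type*}

theorem homogeneousComponent_mul_of_isHomogeneous {R : Type*} [CommRing R]
    {f g : MvPolynomial ι R} {i e : ℕ} (hg : g.IsHomogeneous i) (h : i ≤ e) :
    homogeneousComponent e (f * g) = homogeneousComponent (e - i) f * g := by
  have := DirectSum.coe_decompose_mul_of_right_mem_of_le (homogeneousSubmodule ι R) (a := f)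
    (b := g) (i := i) (n := e) hg h
  erw [decomposition.decompose'_apply, decomposition.decompose'_apply] at this
  exact this

/-- If a homogeneous ideal together with linear forms `y` cuts out the origin only, then modulo
the ideal the polynomial ring is integral over the ring generated by `y`. -/
theorem exists_monic_of_radical [Finite ι] [Field k] {J : Ideal (MvPolynomial ι k)}
    (hJ : J.IsHomogeneous (homogeneousSubmodule ι k)) {D : ℕ} {y : Fin D → MvPolynomial ι k}
    (hy : ∀ t, (y t).IsHomogeneous 1)
    (h : ∀ i, X i ∈ (J ⊔ Ideal.span (Set.range y)).radical) (v : ι) :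
    ∃ P : Polynomial (MvPolynomial (Fin D) k), P.Monic ∧
      P.eval₂ (bind₁ y : MvPolynomial (Fin D) k →+* MvPolynomial ι k) (X v) ∈ J := by
  have hle : idealOfVars ι k ≤ (J ⊔ Ideal.span (Set.range y)).radical := by
    rw [idealOfVars, Ideal.span_le]
    rintro _ ⟨i, rfl⟩
    exact h i
  obtain ⟨K, hK⟩ := Ideal.exists_pow_le_of_le_radical_of_fg hle (idealOfVars_fg ι k)
  let f : MvPolynomial (Fin D) k →+* MvPolynomial ι k ⧸ J :=
    (Ideal.Quotient.mk J).comp (bind₁ y : MvPolynomial (Fin D) k →+* MvPolynomial ι k)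
  suffices hf : f.Finite by
    obtain ⟨P, hP, hP0⟩ := hf.to_isIntegral (Ideal.Quotient.mk J (X v))
    refine ⟨P, hP, ?_⟩
    rw [← Ideal.Quotient.eq_zero_iff_mem, Polynomial.hom_eval₂]
    exact hP0
  let alg : Algebra (MvPolynomial (Fin D) k) (MvPolynomial ι k ⧸ J) := f.toAlgebra
  let md : Module (MvPolynomial (Fin D) k) (MvPolynomial ι k ⧸ J) := alg.toModule
  let sm : SMul (MvPolynomial (Fin D) k) (MvPolynomial ι k ⧸ J) := md.toSMul
  have hsm : ∀ (a : MvPolynomial (Fin D) k) (x : MvPolynomial ι k),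
      a • (Ideal.Quotient.mk J x) = Ideal.Quotient.mk J (bind₁ y a * x) := fun a x => by
    rw [map_mul]; exact Algebra.smul_def (A := MvPolynomial ι k ⧸ J) a _
  let T : Set (MvPolynomial ι k ⧸ J) :=
    (fun m => Ideal.Quotient.mk J (monomial m (1 : k))) '' {m : ι →₀ ℕ | m.degree ≤ K}
  have hT : T.Finite := (Finsupp.finite_of_degree_le K).image _
  let N := Submodule.span (MvPolynomial (Fin D) k) T
  have key : ∀ e, ∀ g : MvPolynomial ι k, g.IsHomogeneous e → Ideal.Quotient.mk J g ∈ N := by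
    intro e
    induction e using Nat.strong_induction_on with
    | _ e ih =>
      intro g hg
      by_cases he : e ≤ K
      · rw [g.as_sum, map_sum]
        refine Submodule.sum_mem _ fun m hm => ?_
        have hdeg : m.degree = e := by
          rw [Finsupp.degree_eq_weight_one]; exact hg (mem_support_iff.1 hm)
        have : monomial m (coeff m g) = bind₁ y (C (coeff m g)) * monomial m 1 := by
          simp [C_mul_monomial]
        rw [this, ← hsm]
        exact N.smul_mem _ (Submodule.subset_span ⟨m, by simp [hdeg, he], rfl⟩)
      · have hgI : g ∈ J ⊔ Ideal.span (Set.range y) := by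
          refine hK ((mem_pow_idealOfVars_iff _ _).2 fun m hm => ?_)
          have hdeg : m.degree = e := by
            rw [Finsupp.degree_eq_weight_one]; exact hg (mem_support_iff.1 hm)
          rw [hdeg]; omega
        obtain ⟨j, hj, z, hz, rfl⟩ := Submodule.mem_sup.1 hgI
        obtain ⟨c, rfl⟩ := Ideal.mem_span_range_iff_exists_fun.1 hz
        rw [← homogeneousComponent_eq_self hg, map_add, map_sum, map_add, map_sum]
        refine N.add_mem ?_ (Submodule.sum_mem _ fun t _ => ?_)
        · rw [Ideal.Quotient.eq_zero_iff_mem.2 (homogeneousComponent_mem_of_mem hJ hj e)]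
          exact N.zero_mem
        · rw [homogeneousComponent_mul_of_isHomogeneous (hy t) (by omega)]
          have := N.smul_mem (X t : MvPolynomial (Fin D) k)
            (ih (e - 1) (by omega) _ (homogeneousComponent_isHomogeneous (e - 1) (c t)))
          rwa [hsm, bind₁_X_right, mul_comm] at this
  have htop : N = ⊤ := by
    rw [eq_top_iff]
    rintro x -
    obtain ⟨g, rfl⟩ := Ideal.Quotient.mk_surjective x
    rw [← sum_homogeneousComponent g, map_sum]
    exact Submodule.sum_mem _ fun e _ => key e _ (homogeneousComponent_isHomogeneous e g)
  have hfg : (⊤ : Submodule (MvPolynomial (Fin D) k) (MvPolynomial ι k ⧸ J)).FG :=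
    ⟨hT.toFinset, by rw [hT.coe_toFinset]; exact htop⟩
  exact Module.Finite.of_fg_top hfg

theorem map_castRingHom_C (z : ℤ) :
    map (Int.castRingHom ℚ) (C z : MvPolynomial ι ℤ) = C (z : ℚ) := map_C _ _

theorem exists_int_mul_eq_map (f : MvPolynomial ι ℚ) :
    ∃ m : ℤ, m ≠ 0 ∧ ∃ g, map (Int.castRingHom ℚ) g = C (m : ℚ) * f := by
  induction f using MvPolynomial.induction_on with
  | C a =>
    refine ⟨a.den, by exact_mod_cast a.den_ne_zero, C a.num, ?_⟩
    rw [map_C, ← C_mul]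
    congr 1
    have := Rat.mul_den_eq_num a
    simp only [eq_intCast, Int.cast_natCast]
    linarith
  | add p q hp hq =>
    obtain ⟨m, hm, g, hg⟩ := hp
    obtain ⟨m', hm', g', hg'⟩ := hq
    refine ⟨m * m', mul_ne_zero hm hm', C m' * g + C m * g', ?_⟩
    simp only [map_add, map_mul, hg, hg', map_castRingHom_C, Int.cast_mul]
    ring
  | mul_X p i hp =>
    obtain ⟨m, hm, g, hg⟩ := hp
    refine ⟨m, hm, g * X i, ?_⟩
    simp only [map_mul, hg, map_X]
    ring

theorem exists_int_mul_eq_map_family {τ : Type*} (s : Finset τ) (f : τ → MvPolynomial ι ℚ) :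
    ∃ m : ℤ, m ≠ 0 ∧ ∃ g : τ → MvPolynomial ι ℤ,
      ∀ t ∈ s, map (Int.castRingHom ℚ) (g t) = C (m : ℚ) * f t := by
  choose m hm g hg using fun t => exists_int_mul_eq_map (f t)
  refine ⟨∏ t ∈ s, m t, Finset.prod_ne_zero_iff.2 fun t _ => hm t,
    fun t => C (∏ u ∈ s.erase t, m u) * g t, fun t ht => ?_⟩
  rw [map_mul, hg, map_C, ← Finset.mul_prod_erase s m ht]
  simp only [eq_intCast, Int.cast_mul, map_mul]
  ring

theorem exists_int_relation [Fintype ι] {κ : Type*} [Fintype κ] {M : κ → MvPolynomial ι ℤ}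
    {e : ℕ} (hM : ∀ i, (M i).IsHomogeneous e) {D : ℕ} {y : Fin D → ι → ℤ}
    (h : ∀ i, X i ∈ (Ideal.span (Set.range fun i => map (Int.castRingHom ℚ) (M i)) ⊔
      Ideal.span (Set.range fun t => linForm fun i => (y t i : ℚ))).radical) (v : ι) :
    ∃ m : ℤ, m ≠ 0 ∧ ∃ (l : ℕ) (c : ℕ → MvPolynomial (Fin D) ℤ) (a : κ → MvPolynomial ι ℤ),
      C m * X v ^ l + ∑ j ∈ Finset.range l, bind₁ (fun t => linForm (y t)) (c j) * X v ^ j =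
        ∑ i, a i * M i := by
  have hJ : (Ideal.span (Set.range fun i => map (Int.castRingHom ℚ) (M i))).IsHomogeneous
      (homogeneousSubmodule ι ℚ) := by
    refine Ideal.homogeneous_span _ _ ?_
    rintro _ ⟨i, rfl⟩
    exact ⟨e, (hM i).map _⟩
  obtain ⟨P, hP, hPJ⟩ := exists_monic_of_radical hJ (fun t => linForm_isHomogeneous _) h v
  obtain ⟨b, hb⟩ := Ideal.mem_span_range_iff_exists_fun.1 hPJ
  obtain ⟨m₁, hm₁, c, hc⟩ := exists_int_mul_eq_map_family (Finset.range P.natDegree) P.coeff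
  obtain ⟨m₂, hm₂, a, ha⟩ := exists_int_mul_eq_map_family Finset.univ b
  refine ⟨m₁ * m₂, mul_ne_zero hm₁ hm₂, P.natDegree, fun j => C m₂ * c j, fun i => C m₁ * a i, ?_⟩
  apply map_injective (Int.castRingHom ℚ) Int.cast_injective
  rw [Polynomial.eval₂_eq_sum_range, Finset.sum_range_succ, hP.coeff_natDegree] at hb
  have hlin : ∀ t, map (Int.castRingHom ℚ) (linForm (y t)) = linForm fun i => (y t i : ℚ) := by
    intro t; simp [linForm]
  have hc' : ∀ j ∈ Finset.range P.natDegree,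
      map (Int.castRingHom ℚ) (bind₁ (fun t => linForm (y t)) (c j)) =
        C (m₁ : ℚ) * bind₁ (fun t => linForm fun i => (y t i : ℚ)) (P.coeff j) := by
    intro j hj
    rw [map_bind₁, hc j hj]
    simp [hlin]
  have hL : ∑ j ∈ Finset.range P.natDegree, map (Int.castRingHom ℚ)
      (bind₁ (fun t => linForm (y t)) (C m₂ * c j) * X v ^ j) =
      C (m₁ : ℚ) * C (m₂ : ℚ) * ∑ j ∈ Finset.range P.natDegree,
        bind₁ (fun t => linForm fun i => (y t i : ℚ)) (P.coeff j) * X v ^ j := by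
    rw [Finset.mul_sum]
    refine Finset.sum_congr rfl fun j hj => ?_
    rw [map_mul, map_mul, map_mul, hc' j hj]
    simp only [bind₁_C_right, map_castRingHom_C, map_pow, map_X]
    ring
  rw [map_add, map_sum, map_sum, hL]
  have hR : ∑ i, map (Int.castRingHom ℚ) (C m₁ * a i * M i) =
      C (m₁ : ℚ) * C (m₂ : ℚ) * ∑ i, b i * map (Int.castRingHom ℚ) (M i) := by
    rw [Finset.mul_sum]
    refine Finset.sum_congr rfl fun i hi => ?_
    rw [map_mul, map_mul, ha i hi]
    simp only [map_castRingHom_C]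
    ring
  rw [hR, hb]
  simp only [map_castRingHom_C, map_mul, map_pow, map_X, map_one, one_mul]
  simp only [RingHom.coe_coe]
  ring

end Integrality

section PointCount

variable {ι κ : Type*} [Fintype ι] [Fintype κ] {M : κ → MvPolynomial ι ℤ} {e D : ℕ}
  {y : Fin D → ι → ℤ}

/-- The linear forms `y`, taken on the cone cut out by the forms `M`, have fibres of size bounded
independently of the domain over which points are considered. -/
theorem exists_card_le_mul_card (hM : ∀ i, (M i).IsHomogeneous e)
    (h : ∀ i, X i ∈ (Ideal.span (Set.range fun i => map (Int.castRingHom ℚ) (M i)) ⊔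
      Ideal.span (Set.range fun t => linForm fun i => (y t i : ℚ))).radical) :
    ∃ m : ℤ, m ≠ 0 ∧ ∃ K : ℕ, ∀ (R : Type) [CommRing R] [IsDomain R], (m : R) ≠ 0 →
      ∀ (S : Finset (ι → R)) (T : Finset (Fin D → R)), (∀ x ∈ S, ∀ i, aeval x (M i) = 0) →
        (∀ x ∈ S, (fun t => ∑ i, (y t i : R) * x i) ∈ T) → S.card ≤ K * T.card := by
  choose m hm l c a hrel using exists_int_relation hM h
  refine ⟨∏ v, m v, Finset.prod_ne_zero_iff.2 fun v _ => hm v, ∏ v, l v, ?_⟩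
  intro R _ _ hmR S T hS hT
  have hmv : ∀ v, (m v : R) ≠ 0 := by
    rw [Int.cast_prod, Finset.prod_ne_zero_iff] at hmR
    exact fun v => hmR v (Finset.mem_univ v)
  refine Finset.card_le_mul_card_image_of_maps_to hT _ fun τ _ => ?_
  let Q : ι → Polynomial R := fun v => Polynomial.C (m v : R) * Polynomial.X ^ l v +
    ∑ j ∈ Finset.range (l v), Polynomial.C (aeval τ (c v j)) * Polynomial.X ^ j
  have hdeg : ∀ v, (∑ j ∈ Finset.range (l v),
      Polynomial.C (aeval τ (c v j)) * Polynomial.X ^ j).degree < ((l v : ℕ) : WithBot ℕ) := by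
    intro v
    refine (Polynomial.degree_sum_le _ _).trans_lt ((Finset.sup_lt_iff (WithBot.bot_lt_coe _)).2 ?_)
    intro j hj
    exact (Polynomial.degree_C_mul_X_pow_le j _).trans_lt (by exact_mod_cast Finset.mem_range.1 hj)
  have hQdeg : ∀ v, (Q v).degree = l v := by
    intro v
    have h1 := Polynomial.degree_C_mul_X_pow (l v) (hmv v)
    rw [← h1]
    exact Polynomial.degree_add_eq_left_of_degree_lt (by rw [h1]; exact hdeg v)
  have hQ0 : ∀ v, Q v ≠ 0 := fun v h0 => by
    have := hQdeg v
    rw [h0, Polynomial.degree_zero] at this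
    exact WithBot.bot_ne_coe this
  have hsub : S.filter (fun x => (fun t => ∑ i, (y t i : R) * x i) = τ) ⊆
      Fintype.piFinset fun v => (Q v).roots.toFinset := by
    intro x hx
    rw [Finset.mem_filter] at hx
    rw [Fintype.mem_piFinset]
    intro v
    rw [Multiset.mem_toFinset, Polynomial.mem_roots (hQ0 v), Polynomial.IsRoot]
    have := congrArg (aeval x) (hrel v)
    rw [map_sum, map_add, map_sum] at this
    have hz : ∑ i, aeval x (a v i * M i) = 0 :=
      Finset.sum_eq_zero fun i _ => by rw [map_mul, hS x hx.1 i, mul_zero]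
    rw [hz] at this
    have hlin : ∀ t, aeval x (linForm (y t)) = τ t := by
      intro t
      rw [← hx.2]
      simp [linForm]
    simp only [map_mul, map_pow, aeval_X, aeval_bind₁, hlin] at this
    simp only [Q, Polynomial.eval_add, Polynomial.eval_finsetSum, Polynomial.eval_mul,
      Polynomial.eval_C, Polynomial.eval_pow, Polynomial.eval_X]
    rw [← this]
    simp
  refine (Finset.card_le_card hsub).trans ?_
  rw [Fintype.card_piFinset]
  refine Finset.prod_le_prod' fun v _ => ?_
  refine (Multiset.toFinset_card_le _).trans ((Polynomial.card_roots' _).trans ?_)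
  rw [Polynomial.natDegree_eq_of_degree_eq_some (hQdeg v)]

theorem exists_card_int_points_le (hM : ∀ i, (M i).IsHomogeneous e)
    (h : ∀ i, X i ∈ (Ideal.span (Set.range fun i => map (Int.castRingHom ℚ) (M i)) ⊔
      Ideal.span (Set.range fun t => linForm fun i => (y t i : ℚ))).radical) :
    ∃ K : ℕ, ∀ b : ℕ, 1 ≤ b → ∀ S : Finset (ι → ℤ),
      (∀ x ∈ S, (∀ i, aeval x (M i) = 0) ∧ ∀ v, |x v| ≤ b) → S.card ≤ K * b ^ D := by
  obtain ⟨m, hm, K, hK⟩ := exists_card_le_mul_card hM h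
  let A : ℕ := ∑ t, ∑ i, (y t i).natAbs
  refine ⟨K * (2 * A + 1) ^ D, fun b hb S hS => ?_⟩
  let T : Finset (Fin D → ℤ) := Fintype.piFinset fun _ => Finset.Icc (-(A * b : ℤ)) (A * b)
  have hT : T.card ≤ (2 * A + 1) ^ D * b ^ D := by
    rw [Fintype.card_piFinset, Finset.prod_const, Int.card_Icc, ← mul_pow, Finset.card_univ,
      Fintype.card_fin]
    refine Nat.pow_le_pow_left ?_ D
    rw [Int.toNat_le]
    push_cast
    nlinarith
  calc S.card ≤ K * T.card := by
        refine hK ℤ (by simpa using hm) S T (fun x hx => (hS x hx).1) fun x hx => ?_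
        rw [Fintype.mem_piFinset]
        intro t
        rw [Finset.mem_Icc, ← abs_le]
        calc |∑ i, ((y t i : ℤ) : ℤ) * x i| ≤ ∑ i, |y t i| * b := by
              refine (Finset.abs_sum_le_sum_abs _ _).trans (Finset.sum_le_sum fun i _ => ?_)
              rw [abs_mul]
              exact mul_le_mul_of_nonneg_left ((hS x hx).2 i) (abs_nonneg _)
          _ = ((∑ i, (y t i).natAbs : ℕ) : ℤ) * b := by
              rw [← Finset.sum_mul]; push_cast; rfl
          _ ≤ A * b := by
              refine mul_le_mul_of_nonneg_right ?_ (by positivity)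
              exact_mod_cast Finset.single_le_sum (f := fun t => ∑ i, (y t i).natAbs)
                (fun _ _ => Nat.zero_le _) (Finset.mem_univ t)
    _ ≤ K * ((2 * A + 1) ^ D * b ^ D) := Nat.mul_le_mul_left _ hT
    _ = _ := by ring

theorem exists_card_zmod_points_le (hM : ∀ i, (M i).IsHomogeneous e)
    (h : ∀ i, X i ∈ (Ideal.span (Set.range fun i => map (Int.castRingHom ℚ) (M i)) ⊔
      Ideal.span (Set.range fun t => linForm fun i => (y t i : ℚ))).radical) :
    ∃ K : ℕ, ∀ p : ℕ, p.Prime → ∀ S : Finset (ι → ZMod p),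
      (∀ x ∈ S, ∀ i, aeval x (M i) = 0) → S.card ≤ K * p ^ D := by
  obtain ⟨m, hm, K, hK⟩ := exists_card_le_mul_card hM h
  refine ⟨max K (m.natAbs ^ Fintype.card ι), fun p hp S hS => ?_⟩
  have : Fact p.Prime := ⟨hp⟩
  by_cases hmp : (m : ZMod p) = 0
  · have hle : p ≤ m.natAbs := by
      rw [ZMod.intCast_zmod_eq_zero_iff_dvd] at hmp
      exact Nat.le_of_dvd (Int.natAbs_pos.2 hm) (Int.natCast_dvd.1 hmp)
    calc S.card ≤ Fintype.card (ι → ZMod p) := Finset.card_le_univ S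
      _ = p ^ Fintype.card ι := by rw [Fintype.card_fun, ZMod.card]
      _ ≤ m.natAbs ^ Fintype.card ι := Nat.pow_le_pow_left hle _
      _ ≤ max K (m.natAbs ^ Fintype.card ι) := le_max_right _ _
      _ ≤ _ := Nat.le_mul_of_pos_right _ (pow_pos hp.pos _)
  · calc S.card ≤ K * (Finset.univ : Finset (Fin D → ZMod p)).card :=
          hK (ZMod p) hmp S _ hS fun _ _ => Finset.mem_univ _
      _ = K * p ^ D := by rw [Finset.card_univ, Fintype.card_fun, ZMod.card, Fintype.card_fin]
      _ ≤ _ := Nat.mul_le_mul_right _ (le_max_left _ _)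

end PointCount

section Polarization

variable {ι R S : Type*} [Fintype ι] [CommRing R] [CommRing S]

/-- The derivative of the polynomial `f` in the constant direction `v`. -/
def dirDeriv (v : ι → R) : MvPolynomial ι R →ₗ[R] MvPolynomial ι R :=
  ∑ i, v i • (pderiv i).toLinearMap

theorem dirDeriv_apply (v : ι → R) (f : MvPolynomial ι R) :
    dirDeriv v f = ∑ i, C (v i) * pderiv i f := by
  simp [dirDeriv, C_mul']

theorem dirDeriv_add (v w : ι → R) (f : MvPolynomial ι R) :
    dirDeriv (v + w) f = dirDeriv v f + dirDeriv w f := by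
  simp [dirDeriv_apply, add_mul, Finset.sum_add_distrib]

theorem map_dirDeriv (φ : R →+* S) (v : ι → R) (f : MvPolynomial ι R) :
    map φ (dirDeriv v f) = dirDeriv (φ ∘ v) (map φ f) := by
  simp [dirDeriv_apply, pderiv_map]

theorem pderiv_dirDeriv (v : ι → R) (i : ι) (f : MvPolynomial ι R) :
    pderiv i (dirDeriv v f) = dirDeriv v (pderiv i f) := by
  have key : ∀ j, pderiv i (pderiv j f) = pderiv j (pderiv i f) := by
    intro j
    have h : ⁅pderiv i, pderiv j⁆ = (0 : Derivation R (MvPolynomial ι R) _) :=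
      derivation_ext fun t => by
        classical
        have hX : ∀ j, pderiv j (X t : MvPolynomial ι R) = C (Pi.single (M := fun _ => R) j 1 t) := by
          intro j
          rw [pderiv_X, Pi.single_apply, Pi.single_apply]
          split_ifs <;> simp
        rw [Derivation.commutator_apply, hX, hX, pderiv_C, pderiv_C, sub_zero]
        rfl
    have := congrArg (fun D => D f) h
    simpa [Derivation.commutator_apply, sub_eq_zero] using this
  simp [dirDeriv_apply, key]

theorem dirDeriv_mul_X (v : ι → R) (f : MvPolynomial ι R) (i : ι) :
    dirDeriv v (f * X i) = dirDeriv v f * X i + C (v i) * f := by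
  classical
  simp only [dirDeriv_apply, Derivation.leibniz, smul_eq_mul, pderiv_X, mul_add,
    Finset.sum_add_distrib, Pi.single_apply, Finset.sum_mul]
  rw [add_comm]
  congr 1
  · exact Finset.sum_congr rfl fun _ _ => by ring
  · simp [mul_comm]

/-- The constant term of the iterated derivative of `f` along `h 0, …, h (k - 1)`. -/
def polar : (k : ℕ) → (Fin k → ι → R) → MvPolynomial ι R →ₗ[R] R
  | 0, _ => lcoeff R 0
  | k + 1, h => polar k (Fin.tail h) ∘ₗ dirDeriv (h 0)

theorem polar_zero (h : Fin 0 → ι → R) (f : MvPolynomial ι R) :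
    polar 0 h f = constantCoeff f := rfl

theorem polar_succ (k : ℕ) (h : Fin (k + 1) → ι → R) (f : MvPolynomial ι R) :
    polar (k + 1) h f = polar k (Fin.tail h) (dirDeriv (h 0) f) := rfl

theorem map_polar (φ : R →+* S) (k : ℕ) (h : Fin k → ι → R) (f : MvPolynomial ι R) :
    φ (polar k h f) = polar k (fun j => φ ∘ h j) (map φ f) := by
  induction k generalizing f with
  | zero => simp [polar_zero, constantCoeff_map]
  | succ k ih => rw [polar_succ, polar_succ, ih, map_dirDeriv]; rfl

theorem polar_update_add (k : ℕ) (h : Fin k → ι → R) (j : Fin k) (v w : ι → R)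
    (f : MvPolynomial ι R) :
    polar k (Function.update h j (v + w)) f =
      polar k (Function.update h j v) f + polar k (Function.update h j w) f := by
  induction k generalizing f with
  | zero => exact j.elim0
  | succ k ih =>
    simp only [polar_succ]
    induction j using Fin.cases with
    | zero => simp [Fin.tail_update_zero, dirDeriv_add]
    | succ j =>
      have h0 : ∀ u, Function.update h j.succ u 0 = h 0 := fun u =>
        Function.update_of_ne (Fin.succ_ne_zero j).symm _ _
      simp only [h0, Fin.tail_update_succ]
      exact ih _ _ _

theorem polar_const {k : ℕ} {f : MvPolynomial ι R} (hf : f.IsHomogeneous k) (x : ι → R) :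
    polar k (fun _ => x) f = k.factorial * eval x f := by
  induction k generalizing f with
  | zero =>
    rw [← totalDegree_zero_iff_isHomogeneous, totalDegree_eq_zero_iff_eq_C] at hf
    rw [polar_zero, hf]
    simp
  | succ k ih =>
    have hD : (dirDeriv x f).IsHomogeneous k := by
      rw [dirDeriv_apply]
      exact IsHomogeneous.sum _ _ _ fun i _ => (hf.pderiv (i := i)).C_mul _
    have he := congrArg (eval x) hf.sum_X_mul_pderiv
    rw [polar_succ]
    refine (ih hD).trans ?_
    have : eval x (dirDeriv x f) = (k + 1) * eval x f := by
      rw [dirDeriv_apply]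
      simpa using he
    rw [this, Nat.factorial_succ]
    push_cast
    ring

end Polarization

section PolarForm

variable {ι R : Type*} [Fintype ι] [CommRing R]

theorem polar_isHomogeneous {τ : Type*} (k e : ℕ) (h : Fin k → ι → MvPolynomial τ R)
    (hh : ∀ j i, (h j i).IsHomogeneous 1) (f : MvPolynomial ι (MvPolynomial τ R))
    (hf : ∀ s, (coeff s f).IsHomogeneous e) : (polar k h f).IsHomogeneous (e + k) := by
  induction k generalizing f e with
  | zero => exact hf 0
  | succ k ih =>
    have hek : e + (k + 1) = e + 1 + k := by ring
    rw [polar_succ, hek]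
    refine ih (e + 1) _ (fun j i => hh _ _) _ fun s => ?_
    rw [dirDeriv_apply, coeff_sum]
    refine IsHomogeneous.sum _ _ _ fun i _ => ?_
    rw [coeff_C_mul, coeff_pderiv, add_comm e]
    refine (hh 0 i).mul ?_
    have h1 : ((s i : MvPolynomial τ R) + 1) = C ((s i : R) + 1) := by simp
    rw [h1, mul_comm]
    exact (hf _).C_mul _

/-- The polarization, in `k` generic directions, of the partial derivative `∂F/∂xᵢ`. -/
def polarForm (F : MvPolynomial ι R) (k : ℕ) (i : ι) : MvPolynomial (Fin k × ι) R :=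
  polar k (fun j i => X (j, i)) (map C (pderiv i F))

theorem polarForm_isHomogeneous (F : MvPolynomial ι R) (k : ℕ) (i : ι) :
    (polarForm F k i).IsHomogeneous k := by
  have := polar_isHomogeneous (R := R) (τ := Fin k × ι) k 0 (fun j i => X (j, i))
    (fun j i => isHomogeneous_X _ _) (map C (pderiv i F)) fun s => by
      rw [coeff_map]
      exact isHomogeneous_C _ _
  rwa [zero_add] at this

theorem aeval_polarForm {S : Type*} [CommRing S] [Algebra R S] (F : MvPolynomial ι R) (k : ℕ)
    (i : ι) (x : Fin k × ι → S) :
    aeval x (polarForm F k i) =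
      polar k (fun j i => x (j, i)) (pderiv i (map (algebraMap R S) F)) := by
  have h1 := map_polar (aeval x : MvPolynomial (Fin k × ι) R →ₐ[R] S).toRingHom k
    (fun j i => X (j, i)) (map C (pderiv i F))
  have h2 : ((aeval x : MvPolynomial (Fin k × ι) R →ₐ[R] S).toRingHom).comp C =
      algebraMap R S := by
    ext r
    simp
  rw [map_map, h2] at h1
  rw [pderiv_map]
  refine h1.trans ?_
  congr 2
  ext j i
  simp

end PolarForm

section Differences

variable {ι R : Type*} [CommRing R]

/-- The polynomials of degree less than `m`. -/
def degLT (ι R : Type*) [CommRing R] (m : ℕ) : Submodule R (MvPolynomial ι R) :=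
  restrictSupport R {s | s.degree < m}

theorem mem_degLT {m : ℕ} {f : MvPolynomial ι R} :
    f ∈ degLT ι R m ↔ ∀ s ∈ f.support, s.degree < m := mem_restrictSupport_iff R

theorem degLT_mono {m m' : ℕ} (h : m ≤ m') : degLT ι R m ≤ degLT ι R m' :=
  restrictSupport_mono R fun _ hs => lt_of_lt_of_le hs h

theorem degLT_zero : degLT ι R 0 = ⊥ := by
  rw [eq_bot_iff]
  intro f hf
  rw [mem_degLT] at hf
  simpa using Finset.eq_empty_of_forall_notMem fun s hs => Nat.not_lt_zero _ (hf s hs)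

theorem mul_X_mem_degLT {m : ℕ} {f : MvPolynomial ι R} (hf : f ∈ degLT ι R m) (i : ι) :
    f * X i ∈ degLT ι R (m + 1) := by
  rw [mem_degLT] at hf ⊢
  intro s hs
  rw [support_mul_X, Finset.mem_map] at hs
  obtain ⟨t, ht, rfl⟩ := hs
  have := hf t ht
  simp only [addRightEmbedding_apply, map_add, Finsupp.degree_single]
  omega

theorem pderiv_mem_degLT {m : ℕ} {f : MvPolynomial ι R} (hf : f ∈ degLT ι R (m + 1)) (i : ι) :
    pderiv i f ∈ degLT ι R m := by
  rw [mem_degLT] at hf ⊢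
  intro s hs
  rw [mem_support_iff, coeff_pderiv] at hs
  have := hf _ (mem_support_iff.2 (left_ne_zero_of_mul hs))
  simp only [map_add, Finsupp.degree_single] at this
  omega

/-- The difference `f (x + v) - f x` as a polynomial in `x`. -/
def polyDiff (v : ι → R) : MvPolynomial ι R →ₗ[R] MvPolynomial ι R :=
  (bind₁ fun i => X i + C (v i)).toLinearMap - LinearMap.id

theorem polyDiff_apply (v : ι → R) (f : MvPolynomial ι R) :
    polyDiff v f = bind₁ (fun i => X i + C (v i)) f - f := rfl

theorem eval_polyDiff (v x : ι → R) (f : MvPolynomial ι R) :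
    eval x (polyDiff v f) = eval (x + v) f - eval x f := by
  rw [polyDiff_apply, map_sub]
  congr 1
  rw [← coe_aeval_eq_eval, RingHom.coe_coe, aeval_bind₁, ← coe_aeval_eq_eval, RingHom.coe_coe]
  congr 2
  ext i
  simp

/-- The iterated difference of `f` along `h 0, …, h (k - 1)`. -/
def iterDiff : (k : ℕ) → (Fin k → ι → R) → MvPolynomial ι R →ₗ[R] MvPolynomial ι R
  | 0, _ => LinearMap.id
  | k + 1, h => iterDiff k (Fin.tail h) ∘ₗ polyDiff (h 0)

theorem iterDiff_zero (h : Fin 0 → ι → R) (f : MvPolynomial ι R) : iterDiff 0 h f = f := rfl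

theorem iterDiff_succ (k : ℕ) (h : Fin (k + 1) → ι → R) (f : MvPolynomial ι R) :
    iterDiff (k + 1) h f = iterDiff k (Fin.tail h) (polyDiff (h 0) f) := rfl

variable [Fintype ι]

theorem dirDeriv_mem_degLT {m : ℕ} {f : MvPolynomial ι R} (hf : f ∈ degLT ι R (m + 1))
    (v : ι → R) : dirDeriv v f ∈ degLT ι R m := by
  rw [dirDeriv_apply]
  refine Submodule.sum_mem _ fun i _ => ?_
  rw [C_mul']
  exact Submodule.smul_mem _ _ (pderiv_mem_degLT hf i)

theorem polar_eq_zero_of_mem_degLT {k : ℕ} {f : MvPolynomial ι R} (hf : f ∈ degLT ι R k)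
    (h : Fin k → ι → R) : polar k h f = 0 := by
  induction k generalizing f with
  | zero =>
    rw [degLT_zero, Submodule.mem_bot] at hf
    rw [hf, map_zero]
  | succ k ih => exact ih (dirDeriv_mem_degLT hf _) _

theorem polyDiff_monomial_mem (v : ι → R) (m : ℕ) (s : ι →₀ ℕ) (hs : s.degree < m + 1) (a : R) :
    polyDiff v (monomial s a) ∈ degLT ι R m ∧
      polyDiff v (monomial s a) - dirDeriv v (monomial s a) ∈ degLT ι R (m - 1) := by
  induction m generalizing s with
  | zero =>
    obtain rfl : s = 0 := by
      rw [← Finsupp.degree_eq_zero_iff]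
      omega
    have h1 : (monomial (0 : ι →₀ ℕ) a) = C a := rfl
    simp [h1, polyDiff_apply, dirDeriv_apply]
  | succ m ih =>
    by_cases hs0 : s = 0
    · subst hs0
      have h1 : (monomial (0 : ι →₀ ℕ) a) = C a := rfl
      simp [h1, polyDiff_apply, dirDeriv_apply]
    obtain ⟨i, hi⟩ : ∃ i, s i ≠ 0 := by
      by_contra! h
      exact hs0 (Finsupp.ext h)
    have hst : s - Finsupp.single i 1 + Finsupp.single i 1 = s :=
      tsub_add_cancel_of_le (by simpa [Nat.one_le_iff_ne_zero] using hi)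
    set t := s - Finsupp.single i 1 with ht
    have htd : t.degree < m + 1 := by
      rw [← hst, map_add, Finsupp.degree_single] at hs
      omega
    obtain ⟨h1, h2⟩ := ih t htd
    have hmon : monomial s a = monomial t a * X i := by
      rw [← hst, X, monomial_mul, mul_one]
    have hf : monomial t a ∈ degLT ι R (m + 1) := (monomial_mem_restrictSupport R).2 (Or.inl htd)
    have e1 : polyDiff v (monomial s a) =
        polyDiff v (monomial t a) * X i + v i • (polyDiff v (monomial t a) + monomial t a) := by
      rw [hmon, polyDiff_apply, polyDiff_apply, map_mul, bind₁_X_right, smul_eq_C_mul]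
      ring
    have e2 : polyDiff v (monomial s a) - dirDeriv v (monomial s a) =
        (polyDiff v (monomial t a) - dirDeriv v (monomial t a)) * X i +
          v i • polyDiff v (monomial t a) := by
      rw [e1, hmon, dirDeriv_mul_X, smul_eq_C_mul, smul_eq_C_mul]
      ring
    constructor
    · rw [e1]
      exact Submodule.add_mem _ (mul_X_mem_degLT h1 i) (Submodule.smul_mem _ _
        (Submodule.add_mem _ (degLT_mono (Nat.le_succ m) h1) hf))
    · rw [e2, Nat.add_sub_cancel]
      refine Submodule.add_mem _ ?_ (Submodule.smul_mem _ _ h1)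
      cases m with
      | zero =>
        rw [Nat.zero_sub, degLT_zero, Submodule.mem_bot] at h2
        rw [h2, zero_mul]
        exact Submodule.zero_mem _
      | succ m => exact mul_X_mem_degLT h2 i

theorem polyDiff_mem_degLT (v : ι → R) {m : ℕ} {f : MvPolynomial ι R}
    (hf : f ∈ degLT ι R (m + 1)) :
    polyDiff v f ∈ degLT ι R m ∧ polyDiff v f - dirDeriv v f ∈ degLT ι R (m - 1) := by
  rw [mem_degLT] at hf
  rw [f.as_sum, map_sum, map_sum, ← Finset.sum_sub_distrib]
  exact ⟨Submodule.sum_mem _ fun s hs => (polyDiff_monomial_mem v m s (hf s hs) _).1,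
    Submodule.sum_mem _ fun s hs => (polyDiff_monomial_mem v m s (hf s hs) _).2⟩

theorem eval_iterDiff {k : ℕ} {f : MvPolynomial ι R} (hf : f ∈ degLT ι R (k + 2))
    (h : Fin k → ι → R) (x : ι → R) :
    eval x (iterDiff k h f) =
      eval 0 (iterDiff k h f) + ∑ i, x i * polar k h (pderiv i f) := by
  induction k generalizing f with
  | zero =>
    have h1 := (polyDiff_mem_degLT x hf).2
    rw [degLT_zero, Submodule.mem_bot] at h1
    have h2 := congrArg (eval 0) h1
    rw [map_sub, eval_polyDiff, dirDeriv_apply] at h2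
    simp only [zero_add, map_sum, map_mul, eval_C, map_zero] at h2
    simp only [iterDiff_zero, polar_zero, ← eval_zero]
    rw [sub_eq_zero, sub_eq_iff_eq_add'] at h2
    simpa using h2
  | succ k ih =>
    obtain ⟨h1, h2⟩ := polyDiff_mem_degLT (h 0) hf
    simp only [iterDiff_succ, polar_succ]
    rw [ih h1]
    congr 1
    refine Finset.sum_congr rfl fun i _ => ?_
    rw [← pderiv_dirDeriv, ← sub_eq_zero, ← mul_sub, ← map_sub, ← map_sub,
      polar_eq_zero_of_mem_degLT (pderiv_mem_degLT h2 i), mul_zero]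

end Differences

section PolarDimension

attribute [local instance] MvPolynomial.gradedAlgebra

theorem exists_int_smul_eq {α : Type*} [Finite α] (a : α → ℚ) :
    ∃ N : ℤ, N ≠ 0 ∧ ∃ b : α → ℤ, ∀ t, (b t : ℚ) = N * a t := by
  obtain ⟨N, hN⟩ := IsLocalization.exist_integer_multiples_of_finite (nonZeroDivisors ℤ) a
  choose b hb using hN
  refine ⟨N, nonZeroDivisors.ne_zero N.2, b, fun t => ?_⟩
  have := hb t
  rw [Algebra.smul_def] at this
  simpa using this

/-- If the singular locus of `F` has dimension at most `σ`, the cone cut out by the polarized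
derivatives of `F` in `m + 1` directions has dimension at most `n m + σ`. -/
theorem exists_linForms_polarForm {n m σ : ℕ} {F : MvPolynomial (Fin n) ℤ}
    (hF : F.IsHomogeneous (m + 2)) (hσ : singDim n ℚ (map (Int.castRingHom ℚ) F) ≤ (σ : ℕ)) :
    ∃ y : Fin (m * n + σ) → Fin (m + 1) × Fin n → ℤ,
      ∀ p, X p ∈ (Ideal.span (Set.range fun i =>
          map (Int.castRingHom ℚ) (polarForm F (m + 1) i)) ⊔
        Ideal.span (Set.range fun t => linForm fun i => (y t i : ℚ))).radical := by
  set G := map (Int.castRingHom ℚ) F with hG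
  have hGd : ∀ i, (pderiv i G).IsHomogeneous (m + 1) := fun i => by
    have := (hF.map (Int.castRingHom ℚ)).pderiv (i := i)
    exact this
  obtain ⟨a, ha⟩ := exists_linForms_radical σ (Ideal.span (Set.range fun i => pderiv i G))
    (Ideal.homogeneous_span _ _ (by
      rintro _ ⟨i, rfl⟩
      exact ⟨m + 1, hGd i⟩))
    (by rw [← ringKrullDim_quotient]; exact hσ)
  obtain ⟨N, hN, b, hb⟩ := exists_int_smul_eq fun t : Fin σ × Fin n => a t.1 t.2
  let y₀ : (Fin m × Fin n) ⊕ Fin σ → Fin (m + 1) × Fin n → ℤ := Sum.elim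
    (fun s => Pi.single (s.1.succ, s.2) 1 - Pi.single (0, s.2) 1)
    (fun t p => if p.1 = 0 then b (t, p.2) else 0)
  have e : Fin (m * n + σ) ≃ (Fin m × Fin n) ⊕ Fin σ := Fintype.equivOfCardEq (by simp)
  refine ⟨y₀ ∘ e, ?_⟩
  have hrange : (Set.range fun t => linForm fun i => (((y₀ ∘ e) t i : ℤ) : ℚ)) =
      Set.range fun t => linForm fun i => ((y₀ t i : ℤ) : ℚ) :=
    e.surjective.range_comp fun t => linForm fun i => ((y₀ t i : ℤ) : ℚ)
  rw [hrange]
  set I := Ideal.span (Set.range fun i => map (Int.castRingHom ℚ) (polarForm F (m + 1) i)) ⊔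
    Ideal.span (Set.range fun t => linForm fun i => ((y₀ t i : ℤ) : ℚ)) with hI
  let π := Ideal.Quotient.mkₐ ℚ I
  have hy : ∀ t, π (linForm fun i => ((y₀ t i : ℤ) : ℚ)) = 0 := fun t =>
    Ideal.Quotient.eq_zero_iff_mem.2
      (Ideal.mem_sup_right (Ideal.subset_span ⟨t, rfl⟩))
  have hdiag : ∀ j i, π (X (j, i)) = π (X (0, i)) := by
    intro j i
    induction j using Fin.cases with
    | zero => rfl
    | succ j =>
      have h := hy (Sum.inl (j, i))
      have h1 : (linForm fun p => ((y₀ (Sum.inl (j, i)) p : ℤ) : ℚ)) =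
          X (j.succ, i) - X (0, i) := by
        simp only [linForm, y₀, Sum.elim_inl, Pi.sub_apply, Int.cast_sub, map_sub, sub_mul,
          Finset.sum_sub_distrib]
        simp [Pi.single_apply]
      rwa [h1, map_sub, sub_eq_zero] at h
  let φ : MvPolynomial (Fin n) ℚ →ₐ[ℚ] _ := aeval fun i => π (X (0, i))
  have hφ : ∀ f ∈ Ideal.span (Set.range fun i => pderiv i G) ⊔
      Ideal.span (Set.range fun t => linForm (a t)), φ f = 0 := by
    suffices hle : _ ≤ RingHom.ker φ from fun f hf => RingHom.mem_ker.1 (hle hf)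
    rw [sup_le_iff, Ideal.span_le, Ideal.span_le]
    constructor
    · rintro _ ⟨i, rfl⟩
      rw [SetLike.mem_coe, RingHom.mem_ker]
      have h1 : π (map (Int.castRingHom ℚ) (polarForm F (m + 1) i)) = 0 :=
        Ideal.Quotient.eq_zero_iff_mem.2 (Ideal.mem_sup_left (Ideal.subset_span ⟨i, rfl⟩))
      have h2 : π (map (Int.castRingHom ℚ) (polarForm F (m + 1) i)) =
          aeval (fun p : Fin (m + 1) × Fin n => π (X (0, p.2))) (polarForm F (m + 1) i) := by
        have h3 : π.restrictScalars ℤ = (aeval (R := ℚ) fun p => π (X p)).restrictScalars ℤ := by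
          congr 1
          exact algHom_ext fun p => by simp
        have h4 : ∀ g, π g = aeval (R := ℚ) (fun p => π (X p)) g := fun g =>
          congrArg (fun ψ => ψ g) h3
        rw [h4, ← algebraMap_int_eq, aeval_map_algebraMap]
        congr 2
        ext p
        exact hdiag p.1 p.2
      rw [h2, aeval_polarForm] at h1
      have h5 : map (algebraMap ℤ (MvPolynomial (Fin (m + 1) × Fin n) ℚ ⧸ I)) F =
          map (algebraMap ℚ (MvPolynomial (Fin (m + 1) × Fin n) ℚ ⧸ I)) G := by
        rw [hG, map_map]
        congr 1
      rw [h5, pderiv_map] at h1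
      replace h1 : polar (m + 1) (fun _ i => π (X (0, i))) (map (algebraMap ℚ _)
        (pderiv i G)) = 0 := h1
      rw [polar_const ((hGd i).map _), eval_map, ← aeval_def] at h1
      have h6 : ((m + 1).factorial : ℚ) • φ (pderiv i G) = 0 := by
        rw [Algebra.smul_def, map_natCast]
        exact h1
      exact (smul_eq_zero_iff_right (by positivity)).1 h6
    · rintro _ ⟨t, rfl⟩
      rw [SetLike.mem_coe, RingHom.mem_ker]
      have h1 := hy (Sum.inr t)
      have h2 : (linForm fun p => ((y₀ (Sum.inr t) p : ℤ) : ℚ)) =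
          ∑ i, C (N * a t i) * X (0, i) := by
        simp only [linForm, y₀, Sum.elim_inr, Fintype.sum_prod_type]
        rw [Finset.sum_eq_single 0]
        · exact Finset.sum_congr rfl fun i _ => by rw [if_pos rfl, hb (t, i)]
        · intro j _ hj
          simp [hj]
        · simp
      have h3 : (N : ℚ) • φ (linForm (a t)) = 0 := by
        rw [← h1, h2]
        simp only [linForm, map_sum, map_mul, Finset.mul_sum, φ, aeval_X, algHom_C,
          Algebra.smul_def, mul_assoc]
      exact (smul_eq_zero_iff_right (by exact_mod_cast hN)).1 h3
  rintro ⟨j, i⟩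
  obtain ⟨l, hl⟩ := ha i
  refine ⟨l, Ideal.Quotient.eq_zero_iff_mem.1 ?_⟩
  change π (X (j, i) ^ l) = 0
  have := hφ _ hl
  simp only [φ, map_pow, aeval_X] at this
  rw [map_pow, hdiag, this]

end PolarDimension

section Weyl

variable {ι R : Type*} [Fintype ι] [CommRing R] [Fintype R]

/-- The complete exponential sum of the polynomial `f`. -/
def complSum (ψ : AddChar R ℂ) (f : MvPolynomial ι R) : ℂ := ∑ x : ι → R, ψ (eval x f)

theorem norm_complSum_sq_le (ψ : AddChar R ℂ) (f : MvPolynomial ι R) :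
    ‖complSum ψ f‖ ^ 2 ≤ ∑ h : ι → R, ‖complSum ψ (polyDiff h f)‖ := by
  have h1 : ((‖complSum ψ f‖ ^ 2 : ℝ) : ℂ) = ∑ h : ι → R, complSum ψ (polyDiff h f) := by
    push_cast
    rw [← Complex.conj_mul', complSum, map_sum, Finset.sum_mul_sum]
    simp only [complSum]
    rw [Finset.sum_comm (s := (Finset.univ : Finset (ι → R)))
      (f := fun h x => ψ (eval x (polyDiff h f)))]
    refine Finset.sum_congr rfl fun x _ => ?_
    rw [← Equiv.sum_comp (Equiv.addLeft x) fun y => (starRingEnd ℂ) (ψ (eval x f)) * ψ (eval y f)]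
    refine Finset.sum_congr rfl fun h _ => ?_
    rw [eval_polyDiff, sub_eq_neg_add, AddChar.map_add_eq_mul, AddChar.map_neg_eq_conj]
    rfl
  calc ‖complSum ψ f‖ ^ 2 = ‖((‖complSum ψ f‖ ^ 2 : ℝ) : ℂ)‖ := by
        rw [Complex.norm_real, Real.norm_of_nonneg (by positivity)]
    _ ≤ _ := by
        rw [h1]
        exact norm_sum_le _ _

theorem norm_complSum_pow_le (ψ : AddChar R ℂ) (k : ℕ) (f : MvPolynomial ι R) :
    (‖complSum ψ f‖ / Fintype.card (ι → R)) ^ 2 ^ k ≤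
      (∑ h : Fin k → ι → R, ‖complSum ψ (iterDiff k h f)‖ / Fintype.card (ι → R)) /
        Fintype.card (ι → R) ^ k := by
  have hc : (0 : ℝ) < Fintype.card (ι → R) := by exact_mod_cast Fintype.card_pos
  set c : ℝ := (Fintype.card (ι → R) : ℝ) with hcdef
  induction k generalizing f with
  | zero => simp [iterDiff_zero]
  | succ k ih =>
    have h1 : (‖complSum ψ f‖ / c) ^ 2 ≤ (∑ h : ι → R, ‖complSum ψ (polyDiff h f)‖ / c) / c := by
      rw [← Finset.sum_div, div_div, div_pow, sq c]
      gcongr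
      exact norm_complSum_sq_le ψ f
    have h2 : ((∑ h : ι → R, ‖complSum ψ (polyDiff h f)‖ / c) / c) ^ 2 ^ k ≤
        (∑ h : ι → R, (‖complSum ψ (polyDiff h f)‖ / c) ^ 2 ^ k) / c := by
      obtain ⟨N, hN⟩ : ∃ N, 2 ^ k = N + 1 := Nat.exists_eq_succ_of_ne_zero (by positivity)
      have := pow_sum_div_card_le_sum_pow (s := (Finset.univ : Finset (ι → R)))
        (f := fun h => ‖complSum ψ (polyDiff h f)‖ / c) (fun _ _ => by positivity) N
      rw [hN, div_pow, pow_succ c, ← div_div]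
      rw [Finset.card_univ, ← hcdef] at this
      gcongr
    calc (‖complSum ψ f‖ / c) ^ 2 ^ (k + 1) = ((‖complSum ψ f‖ / c) ^ 2) ^ 2 ^ k := by
          rw [← pow_mul, pow_succ' 2]
      _ ≤ ((∑ h : ι → R, ‖complSum ψ (polyDiff h f)‖ / c) / c) ^ 2 ^ k := by gcongr
      _ ≤ (∑ h : ι → R, (‖complSum ψ (polyDiff h f)‖ / c) ^ 2 ^ k) / c := h2
      _ ≤ (∑ v : ι → R, (∑ h : Fin k → ι → R,
            ‖complSum ψ (iterDiff k h (polyDiff v f))‖ / c) / c ^ k) / c := by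
          gcongr with v
          exact ih (polyDiff v f)
      _ = _ := by
          rw [← Finset.sum_div, div_div, ← pow_succ,
            ← (Fin.consEquiv fun _ => ι → R).sum_comp, Fintype.sum_prod_type]
          rfl

theorem complSum_affine {ψ : AddChar R ℂ} (hψ : ψ.IsPrimitive) {g : MvPolynomial ι R} {b : R}
    {c : ι → R} (hg : ∀ x, eval x g = b + ∑ i, x i * c i) :
    ‖complSum ψ g‖ = if c = 0 then (Fintype.card (ι → R) : ℝ) else 0 := by
  have h1 : complSum ψ g = ψ b * ∏ i, ∑ t, ψ (t * c i) := by
    rw [complSum, Fintype.prod_sum, Finset.mul_sum]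
    refine Finset.sum_congr rfl fun x _ => ?_
    rw [hg, AddChar.map_add_eq_mul]
    congr 1
    exact map_prod ψ.toMonoidHom (fun i => Multiplicative.ofAdd (x i * c i)) Finset.univ
  rw [h1, norm_mul, AddChar.norm_apply, one_mul]
  simp only [AddChar.sum_mulShift _ hψ]
  split_ifs with h
  · subst h
    simp
  · obtain ⟨i, hi⟩ := Function.ne_iff.1 h
    rw [Finset.prod_eq_zero (Finset.mem_univ i) (by rw [if_neg (by exact hi), Nat.cast_zero]),
      norm_zero]

/-- The proportion of `k`-tuples of vectors on which the polarized derivatives of `F` vanish. -/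
def polarDensity {ι : Type*} [Fintype ι] (F : MvPolynomial ι ℤ) (k : ℕ) (R : Type*)
    [CommRing R] : ℝ :=
  Nat.card {x : Fin k × ι → R // ∀ i, aeval x (polarForm F k i) = 0} /
    Nat.card (Fin k × ι → R)

theorem polarDensity_nonneg {ι : Type*} [Fintype ι] (F : MvPolynomial ι ℤ) (k : ℕ) (R : Type*)
    [CommRing R] : 0 ≤ polarDensity F k R := by
  unfold polarDensity
  positivity

/-- Weyl's inequality for complete exponential sums. -/
theorem norm_complSum_pow_le_polarDensity {ψ : AddChar R ℂ} (hψ : ψ.IsPrimitive) {k : ℕ}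
    {F : MvPolynomial ι ℤ} (hF : F.IsHomogeneous (k + 1)) :
    (‖complSum ψ (map (Int.castRingHom R) F)‖ / Fintype.card (ι → R)) ^ 2 ^ k ≤
      polarDensity F k R := by
  refine (norm_complSum_pow_le ψ k _).trans (le_of_eq ?_)
  have hdeg : map (Int.castRingHom R) F ∈ degLT ι R (k + 2) := by
    rw [mem_degLT]
    intro s hs
    have := hF.map (Int.castRingHom R) (mem_support_iff.1 hs)
    have hw : (Finsupp.weight (1 : ι → ℕ)) s = s.degree :=
      (DFunLike.congr_fun Finsupp.degree_eq_weight_one s).symm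
    rw [hw] at this
    omega
  have hc : (Fintype.card (ι → R) : ℝ) ≠ 0 := by exact_mod_cast Fintype.card_ne_zero
  have h1 : ∀ h : Fin k → ι → R, ‖complSum ψ (iterDiff k h (map (Int.castRingHom R) F))‖ /
      Fintype.card (ι → R) =
      if ∀ i, polar k h (pderiv i (map (Int.castRingHom R) F)) = 0 then 1 else 0 := by
    intro h
    rw [complSum_affine hψ (eval_iterDiff hdeg h)]
    split_ifs with h0 h1 h1
    · exact div_self hc
    · exact absurd (congrFun h0) h1
    · exact absurd (_root_.funext h1) h0
    · exact zero_div _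
  rw [Finset.sum_congr rfl fun h _ => h1 h, polarDensity]
  congr 1
  · rw [Finset.sum_boole, Nat.cast_inj, Nat.card_eq_fintype_card, ← Fintype.card_subtype]
    refine Fintype.card_congr ((Equiv.curry _ _ _).symm.subtypeEquiv fun h => ?_)
    simp only [aeval_polarForm]
    rfl
  · rw [Nat.card_eq_fintype_card, ← Nat.cast_pow, Nat.cast_inj]
    simp [← pow_mul, mul_comm]

end Weyl

section Pigeonhole

/-- If a set of tuples meets every coordinate line in a subgroup, then differences of points in a
common block show that a positive proportion of it consists of tuples of small vectors. -/
theorem card_le_pow_mul_card_small {κ V β : Type*} [Fintype κ] [DecidableEq κ] [AddCommGroup V] [Fintype V]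
    [Fintype β] (Z : (κ → V) → Prop)
    (hZ : ∀ h j v w, Z (Function.update h j v) → Z (Function.update h j w) →
      Z (Function.update h j (v - w)))
    (box : V → β) (B : V → Prop) (hB : ∀ v w, box v = box w → B (v - w)) :
    (Finset.univ.filter Z).card ≤ Fintype.card β ^ Fintype.card κ *
      (Finset.univ.filter fun h => Z h ∧ ∀ j, B (h j)).card := by
  suffices h : ∀ s : Finset κ, (Finset.univ.filter Z).card ≤ Fintype.card β ^ s.card *
      (Finset.univ.filter fun h => Z h ∧ ∀ j ∈ s, B (h j)).card by
    simpa using h Finset.univ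
  intro s
  induction s using Finset.induction_on with
  | empty => simp
  | insert j s hj ih =>
    refine ih.trans ?_
    rw [Finset.card_insert_of_notMem hj, pow_succ, mul_assoc]
    refine Nat.mul_le_mul_left _ ?_
    rw [← Finset.card_univ, ← Finset.card_product]
    let A : Set (κ → V) := {h | Z h ∧ ∀ i ∈ s, B (h i)}
    let key : (κ → V) → (κ → V) × β := fun h => (Function.update h j (0 : V), box (h j))
    let r : (κ → V) → κ → V := fun h => Function.invFunOn key A (key h)
    have hrA : ∀ h ∈ A, r h ∈ A := fun h hh => Function.invFunOn_mem ⟨h, hh, rfl⟩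
    have hrk : ∀ h ∈ A, key (r h) = key h := fun h hh => Function.invFunOn_eq ⟨h, hh, rfl⟩
    have hup : ∀ (h h' : κ → V) (v : V), Function.update h j (0 : V) = Function.update h' j 0 →
        Function.update h j v = Function.update h' j v := by
      intro h h' v e
      have := congrArg (fun u => Function.update u j v) e
      simpa using this
    refine Finset.card_le_card_of_injOn
      (fun h => (box (h j), Function.update h j (h j - r h j))) ?_ ?_
    · intro h hh
      have hh' : h ∈ A := by simpa [A] using hh
      have hk := hrk h hh'
      simp only [key, Prod.mk.injEq] at hk
      simp only [Finset.coe_product, Finset.coe_univ, Set.mem_prod, Set.mem_univ, true_and,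
        Finset.coe_filter, Finset.mem_univ, Set.mem_ofPred_eq, Finset.mem_insert]
      refine ⟨hZ _ _ _ _ ?_ ?_, ?_⟩
      · rw [Function.update_eq_self]
        exact hh'.1
      · rw [hup h (r h) _ hk.1.symm, Function.update_eq_self]
        exact (hrA h hh').1
      · rintro i (rfl | hi)
        · rw [Function.update_self]
          exact hB _ _ hk.2.symm
        · have hij : i ≠ j := by
            rintro rfl
            exact hj hi
          rw [Function.update_of_ne hij]
          exact hh'.2 i hi
    · intro h _ h' _ e
      simp only [Prod.mk.injEq] at e
      have e1 : Function.update h j (0 : V) = Function.update h' j 0 := by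
        have := congrArg (fun u => Function.update u j (0 : V)) e.2
        simpa using this
      have e2 : r h = r h' := by
        simp only [r, key]
        rw [e1, e.1]
      have e3 := congrFun e.2 j
      rw [Function.update_self, Function.update_self, e2, sub_left_inj] at e3
      have := hup h h' (h j) e1
      rw [Function.update_eq_self, e3, Function.update_eq_self] at this
      exact this

end Pigeonhole

section DensityBound

theorem exists_abs_eval_le {ι : Type*} {k : ℕ} {g : MvPolynomial ι ℤ}
    (hg : g.IsHomogeneous k) :
    ∃ C : ℕ, ∀ (b : ℕ) (z : ι → ℤ), (∀ v, |z v| ≤ b) → |eval z g| ≤ C * b ^ k := by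
  refine ⟨∑ s ∈ g.support, (coeff s g).natAbs, fun b z hz => ?_⟩
  rw [eval_eq, Nat.cast_sum, Finset.sum_mul]
  refine (Finset.abs_sum_le_sum_abs _ _).trans (Finset.sum_le_sum fun s hs => ?_)
  rw [abs_mul, Int.natCast_natAbs, Finset.abs_prod]
  have hw : ∑ i ∈ s.support, s i = k := by
    have h1 : (Finsupp.weight (1 : ι → ℕ)) s = s.degree :=
      (DFunLike.congr_fun Finsupp.degree_eq_weight_one s).symm
    have h2 := hg (mem_support_iff.1 hs)
    rw [h1] at h2
    exact h2
  rw [← hw, ← Finset.prod_pow_eq_pow_sum]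
  gcongr with i _
  rw [abs_pow]
  gcongr
  exact hz i

variable {n m σ : ℕ} {F : MvPolynomial (Fin n) ℤ}

theorem polarDensity_zmod_eq (F : MvPolynomial (Fin n) ℤ) (k q : ℕ) [NeZero q] :
    polarDensity F k (ZMod q) = ((Finset.univ.filter fun x : Fin k × Fin n → ZMod q =>
      ∀ i, aeval x (polarForm F k i) = 0).card : ℝ) / (q : ℝ) ^ (k * n) := by
  rw [polarDensity, Nat.card_eq_fintype_card, Nat.card_eq_fintype_card, Fintype.card_subtype]
  simp

theorem exists_polarDensity_prime_le (hF : F.IsHomogeneous (m + 2))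
    (hσ : singDim n ℚ (map (Int.castRingHom ℚ) F) ≤ (σ : ℕ)) :
    ∃ C : ℝ, 0 < C ∧ ∀ p : ℕ, p.Prime →
      polarDensity F (m + 1) (ZMod p) ≤ C * (p : ℝ) ^ (-((n : ℝ) - σ)) := by
  obtain ⟨y, hy⟩ := exists_linForms_polarForm hF hσ
  obtain ⟨K, hK⟩ := exists_card_zmod_points_le (fun i => polarForm_isHomogeneous F (m + 1) i) hy
  refine ⟨K + 1, by positivity, fun p hp => ?_⟩
  have : Fact p.Prime := ⟨hp⟩
  have hp0 : (0 : ℝ) < p := by exact_mod_cast hp.pos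
  rw [polarDensity_zmod_eq, div_le_iff₀ (by positivity), ← Real.rpow_natCast, mul_assoc,
    ← Real.rpow_add hp0]
  have h1 := hK p hp (Finset.univ.filter fun x : Fin (m + 1) × Fin n → ZMod p =>
      ∀ i, aeval x (polarForm F (m + 1) i) = 0) fun x hx => (Finset.mem_filter.1 hx).2
  have h2 : -((n : ℝ) - σ) + (((m + 1) * n : ℕ) : ℝ) = ((m * n + σ : ℕ) : ℝ) := by
    push_cast
    ring
  rw [h2, Real.rpow_natCast]
  calc _ ≤ (K : ℝ) * p ^ (m * n + σ) := by exact_mod_cast h1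
    _ ≤ _ := by gcongr; linarith

theorem exists_polarDensity_le (hF : F.IsHomogeneous (m + 2))
    (hσ : singDim n ℚ (map (Int.castRingHom ℚ) F) ≤ (σ : ℕ)) (hσn : σ ≤ n) :
    ∃ C : ℝ, 0 < C ∧ ∀ q : ℕ, q ≠ 0 →
      polarDensity F (m + 1) (ZMod q) ≤ C * (q : ℝ) ^ (-(((n : ℝ) - σ) / (m + 1))) := by
  obtain ⟨y, hy⟩ := exists_linForms_polarForm hF hσ
  obtain ⟨K, hK⟩ := exists_card_int_points_le (fun i => polarForm_isHomogeneous F (m + 1) i) hy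
  choose c hc using fun i => exists_abs_eval_le (polarForm_isHomogeneous F (m + 1) i)
  set c₁ : ℕ := ∑ i, c i + 1 with hc₁
  have hc₁0 : (0 : ℝ) < c₁ := by positivity
  refine ⟨(K + 1) * 3 ^ ((m + 1) * n) * (c₁ : ℝ) ^ (((n : ℝ) - σ) / (m + 1)), by positivity,
    fun q hq => ?_⟩
  have : NeZero q := ⟨hq⟩
  have hq0 : (0 : ℝ) < q := by positivity
  set t : ℝ := ((q : ℝ) / c₁) ^ ((1 : ℝ) / (m + 1)) with ht
  have ht0 : 0 < t := by positivity
  have htk : t ^ (m + 1) = q / c₁ := by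
    rw [ht, ← Real.rpow_natCast, ← Real.rpow_mul (by positivity)]
    push_cast
    rw [one_div_mul_cancel (by positivity), Real.rpow_one]
  set f : ℕ := ⌊t⌋₊ with hf
  have hft : (f : ℝ) ≤ t := Nat.floor_le ht0.le
  have htf : t ≤ ((f + 1 : ℕ) : ℝ) := by
    push_cast
    exact (Nat.lt_floor_add_one t).le
  have hfk : c₁ * f ^ (m + 1) ≤ q := by
    have : (c₁ : ℝ) * f ^ (m + 1) ≤ q := by
      calc (c₁ : ℝ) * f ^ (m + 1) ≤ c₁ * t ^ (m + 1) := by gcongr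
        _ = q := by rw [htk]; field_simp
    exact_mod_cast this
  have hfq : f ≤ q := by
    rcases Nat.eq_zero_or_pos f with h0 | h0
    · omega
    · calc f = f ^ 1 := (pow_one f).symm
        _ ≤ f ^ (m + 1) := Nat.pow_le_pow_right h0 (by omega)
        _ ≤ c₁ * f ^ (m + 1) := Nat.le_mul_of_pos_left _ (by omega)
        _ ≤ q := hfk
  -- small integral representatives
  let B : (Fin n → ZMod q) → Prop := fun v => ∀ i, ∃ z : ℤ, |z| ≤ f ∧ (z : ZMod q) = v i
  let box : (Fin n → ZMod q) → Fin n → Fin (q / (f + 1) + 1) := fun v i =>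
    ⟨(v i).val / (f + 1), Nat.lt_succ_of_le (Nat.div_le_div_right (ZMod.val_lt _).le)⟩
  have hbox : ∀ v w, box v = box w → B (v - w) := by
    intro v w e i
    have e1 : (v i).val / (f + 1) = (w i).val / (f + 1) := congrArg Fin.val (congrFun e i)
    refine ⟨((v i).val : ℤ) - (w i).val, ?_, by simp⟩
    have h1 := Nat.div_add_mod (v i).val (f + 1)
    have h2 := Nat.div_add_mod (w i).val (f + 1)
    have h3 : (v i).val % (f + 1) < f + 1 := Nat.mod_lt _ (Nat.succ_pos f)
    have h4 : (w i).val % (f + 1) < f + 1 := Nat.mod_lt _ (Nat.succ_pos f)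
    rw [e1] at h1
    rw [abs_le]
    constructor <;> omega
  let Z : (Fin (m + 1) → Fin n → ZMod q) → Prop := fun h =>
    ∀ i, aeval (fun p : Fin (m + 1) × Fin n => h p.1 p.2) (polarForm F (m + 1) i) = 0
  have hZ : ∀ h j v w, Z (Function.update h j v) → Z (Function.update h j w) →
      Z (Function.update h j (v - w)) := by
    intro h j v w hv hw i
    have hv' := hv i
    have hw' := hw i
    rw [aeval_polarForm] at hv' hw' ⊢
    have := polar_update_add (m + 1) h j (v - w) w (pderiv i (map (algebraMap ℤ (ZMod q)) F))
    rw [sub_add_cancel] at this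
    exact (add_eq_right.1 ((this.symm.trans hv').trans hw'.symm) :)
  have hcard : (Finset.univ.filter Z).card ≤
      Fintype.card (Fin n → Fin (q / (f + 1) + 1)) ^ Fintype.card (Fin (m + 1)) *
        (Finset.univ.filter fun h => Z h ∧ ∀ j, B (h j)).card := by
    convert card_le_pow_mul_card_small Z hZ box B hbox
  have hsmall : (Finset.univ.filter fun h => Z h ∧ ∀ j, B (h j)).card ≤
      K * (f + 1) ^ (m * n + σ) := by
    let lift : (Fin (m + 1) → Fin n → ZMod q) → Fin (m + 1) × Fin n → ℤ := fun h p =>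
      if H : ∃ z : ℤ, |z| ≤ f ∧ (z : ZMod q) = h p.1 p.2 then H.choose else 0
    have hlift : ∀ h, (∀ j, B (h j)) → ∀ p, |lift h p| ≤ f ∧ (lift h p : ZMod q) = h p.1 p.2 := by
      intro h hh p
      have H := hh p.1 p.2
      simp only [lift, dif_pos H]
      exact H.choose_spec
    have hinj : Set.InjOn lift (Finset.univ.filter fun h => Z h ∧ ∀ j, B (h j)) := by
      intro h hh h' hh' e
      simp only [Finset.coe_filter, Finset.mem_univ, true_and, Set.mem_ofPred_eq] at hh hh'
      ext j i
      rw [← (hlift h hh.2 (j, i)).2, ← (hlift h' hh'.2 (j, i)).2, e]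
    rw [← Finset.card_image_of_injOn hinj]
    refine hK (f + 1) (by omega) _ fun z hz => ?_
    obtain ⟨h, hh, rfl⟩ := Finset.mem_image.1 hz
    simp only [Finset.mem_filter, Finset.mem_univ, true_and] at hh
    refine ⟨fun i => ?_, fun v => (hlift h hh.2 v).1.trans (by push_cast; omega)⟩
    have hmod : ((eval (lift h) (polarForm F (m + 1) i) : ℤ) : ZMod q) = 0 := by
      have h1 : (fun p : Fin (m + 1) × Fin n => h p.1 p.2) =
          algebraMap ℤ (ZMod q) ∘ lift h := by
        ext p
        exact (hlift h hh.2 p).2.symm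
      have h2 := hh.1 i
      rwa [h1, aeval_algebraMap_apply] at h2
    rw [ZMod.intCast_zmod_eq_zero_iff_dvd] at hmod
    refine Int.eq_zero_of_abs_lt_dvd hmod (((hc i) f (lift h) fun v => (hlift h hh.2 v).1).trans_lt ?_)
    have h3 : c i + 1 ≤ c₁ := Nat.succ_le_succ (Finset.single_le_sum (f := c)
      (fun _ _ => Nat.zero_le _) (Finset.mem_univ i))
    rcases Nat.eq_zero_or_pos f with h0 | h0
    · rw [h0]
      simpa using Nat.pos_of_ne_zero hq
    · have h4 : c i * f ^ (m + 1) < c₁ * f ^ (m + 1) :=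
        Nat.mul_lt_mul_of_pos_right h3 (by positivity)
      exact_mod_cast h4.trans_le hfk
  have hcurry : (Finset.univ.filter fun x : Fin (m + 1) × Fin n → ZMod q =>
      ∀ i, aeval x (polarForm F (m + 1) i) = 0).card = (Finset.univ.filter Z).card := by
    rw [← Fintype.card_subtype, ← Fintype.card_subtype]
    exact Fintype.card_congr ((Equiv.curry _ _ _).subtypeEquiv fun h => Iff.rfl)
  rw [polarDensity_zmod_eq, hcurry]
  set b : ℝ := ((f + 1 : ℕ) : ℝ) with hb
  have hb0 : 0 < b := by positivity
  have hblocks : ((q / (f + 1) + 1 : ℕ) : ℝ) ≤ 3 * q / b := by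
    rw [le_div_iff₀ hb0, hb]
    have h1 : (q / (f + 1) + 1) * (f + 1) ≤ 3 * q := by
      have := Nat.div_mul_le_self q (f + 1)
      have := Nat.pos_of_ne_zero hq
      rw [add_mul]
      omega
    exact_mod_cast h1
  have hcount : ((Finset.univ.filter Z).card : ℝ) ≤
      (3 * q / b) ^ ((m + 1) * n) * (K * b ^ (m * n + σ)) := by
    have h1 : (Finset.univ.filter Z).card ≤
        (q / (f + 1) + 1) ^ ((m + 1) * n) * (K * (f + 1) ^ (m * n + σ)) := by
      refine hcard.trans (Nat.mul_le_mul (le_of_eq ?_) (by convert hsmall))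
      simp [← pow_mul, mul_comm]
    calc ((Finset.univ.filter Z).card : ℝ) ≤ ((q / (f + 1) + 1 : ℕ) : ℝ) ^ ((m + 1) * n) *
          (K * b ^ (m * n + σ)) := by rw [hb]; exact_mod_cast h1
      _ ≤ _ := by gcongr
  have hN : (m + 1) * n = m * n + σ + (n - σ) := by
    rw [add_mul]
    omega
  have hpow : t ^ (n - σ) = ((q : ℝ) / c₁) ^ (((n : ℝ) - σ) / (m + 1)) := by
    rw [ht, ← Real.rpow_natCast, ← Real.rpow_mul (by positivity), Nat.cast_sub hσn]
    congr 1
    ring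
  calc _ ≤ (3 * q / b) ^ ((m + 1) * n) * (K * b ^ (m * n + σ)) / q ^ ((m + 1) * n) := by gcongr
    _ = K * 3 ^ ((m + 1) * n) * (b ^ (n - σ))⁻¹ := by
        rw [div_pow, mul_pow]
        have : b ^ ((m + 1) * n) = b ^ (m * n + σ) * b ^ (n - σ) := by rw [hN, pow_add]
        rw [this]
        field_simp
    _ ≤ (K + 1) * 3 ^ ((m + 1) * n) * (t ^ (n - σ))⁻¹ := by
        gcongr
        linarith
    _ = _ := by
        rw [hpow, Real.div_rpow hq0.le hc₁0.le, Real.rpow_neg hq0.le, inv_div]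
        ring

end DensityBound

section Multiplicativity

variable {n : ℕ} {ι R S : Type*} [Fintype ι] [CommRing R] [CommRing S]

theorem polarDensity_congr (F : MvPolynomial ι ℤ) (k : ℕ) (e : R ≃+* S) :
    polarDensity F k R = polarDensity F k S := by
  rw [polarDensity, polarDensity, Nat.card_congr (Equiv.arrowCongr (Equiv.refl _) e.toEquiv)]
  congr 2
  refine Nat.card_congr ((Equiv.arrowCongr (Equiv.refl (Fin k × ι)) e.toEquiv).subtypeEquiv
    fun x => forall_congr' fun i => ?_)
  rw [← map_eq_zero_iff e e.injective]
  exact Eq.congr_left (comp_aeval_apply x (e : R →+* S).toIntAlgHom (polarForm F k i))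

theorem polarDensity_prod (F : MvPolynomial ι ℤ) (k : ℕ) :
    polarDensity F k (R × S) = polarDensity F k R * polarDensity F k S := by
  rw [polarDensity, polarDensity, polarDensity, div_mul_div_comm, ← Nat.cast_mul, ← Nat.cast_mul,
    ← Nat.card_prod, ← Nat.card_prod, Nat.card_congr (Equiv.arrowProdEquivProdArrow _ _ _)]
  congr 2
  have hmem (x : Fin k × ι → R × S) : (∀ i, aeval x (polarForm F k i) = 0) ↔
      (∀ i, aeval (fun v => (x v).1) (polarForm F k i) = 0) ∧
        ∀ i, aeval (fun v => (x v).2) (polarForm F k i) = 0 := by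
    rw [← forall_and]
    refine forall_congr' fun i => ?_
    rw [Prod.ext_iff]
    exact and_congr
      (Eq.congr_left (comp_aeval_apply x (RingHom.fst R S).toIntAlgHom (polarForm F k i)))
      (Eq.congr_left (comp_aeval_apply x (RingHom.snd R S).toIntAlgHom (polarForm F k i)))
  exact Nat.card_congr
    { toFun := fun x => (⟨fun v => (x.1 v).1, ((hmem x.1).1 x.2).1⟩,
        ⟨fun v => (x.1 v).2, ((hmem x.1).1 x.2).2⟩)
      invFun := fun x => ⟨fun v => (x.1.1 v, x.2.1 v), (hmem _).2 ⟨x.1.2, x.2.2⟩⟩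
      left_inv := fun _ => rfl
      right_inv := fun _ => rfl }

theorem polarDensity_zmod_mul (F : MvPolynomial ι ℤ) (k : ℕ) {a b : ℕ} (h : a.Coprime b) :
    polarDensity F k (ZMod (a * b)) = polarDensity F k (ZMod a) * polarDensity F k (ZMod b) := by
  rw [polarDensity_congr F k (ZMod.chineseRemainder h), polarDensity_prod]

theorem sum_Icc_eq_sum_zmod {q : ℕ} [NeZero q] {M : Type*} [AddCommMonoid M]
    (χ : (Fin n → ZMod q) → M) (t : Fin n → ℤ) :
    ∑ y ∈ Finset.Icc t (fun i => t i + (q - 1)), χ (fun i => (y i : ZMod q)) = ∑ x, χ x := by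
  refine Finset.sum_bij' (fun y _ i => (y i : ZMod q))
    (fun x _ i => t i + ((x i - (t i : ZMod q)).val : ℤ)) (fun _ _ => Finset.mem_univ _) ?_ ?_ ?_
    (fun _ _ => rfl)
  · intro x _
    rw [Finset.mem_Icc]
    refine ⟨fun i => le_add_of_nonneg_right (Int.natCast_nonneg _), fun i => ?_⟩
    have := ZMod.val_lt (x i - (t i : ZMod q))
    dsimp only
    omega
  · intro y hy
    rw [Finset.mem_Icc] at hy
    ext i
    have h1 := hy.1 i
    have h2 := hy.2 i
    dsimp only at h2 ⊢
    rw [← Int.cast_sub, ZMod.val_intCast, Int.emod_eq_of_lt (sub_nonneg.2 h1) (by linarith)]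
    ring
  · intro x _
    ext i
    simp

end Multiplicativity

section GaussSum

variable {n k q : ℕ} {F : MvPolynomial (Fin n) ℤ}

theorem eC_intCast_div [NeZero q] (j : ℤ) : eC ((j : ℝ) / q) = ZMod.stdAddChar (j : ZMod q) := by
  rw [ZMod.stdAddChar_coe, eC]
  congr 1
  push_cast
  ring

theorem eval_intCast_comp {R : Type*} [CommRing R] (F : MvPolynomial (Fin n) ℤ) (y : Fin n → ℤ) :
    eval (fun i => (y i : R)) (map (Int.castRingHom R) F) = ((eval y F : ℤ) : R) := by
  rw [eval_map]
  exact (eval₂_comp (Int.castRingHom R) y F).symm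

theorem eC_mul_eval_div [NeZero q] (F : MvPolynomial (Fin n) ℤ) (a : ℕ) (y : Fin n → ℤ) :
    eC ((a : ℝ) * (eval y F : ℝ) / q) = (ZMod.stdAddChar (N := q)).mulShift a
      (eval (fun i => (y i : ZMod q)) (map (Int.castRingHom (ZMod q)) F)) := by
  rw [AddChar.mulShift_apply, eval_intCast_comp]
  have := eC_intCast_div (q := q) ((a : ℤ) * eval y F)
  push_cast at this
  exact this

theorem gaussSumF_eq_complSum [NeZero q] (F : MvPolynomial (Fin n) ℤ) (a : ℕ) :
    gaussSumF n F q a = complSum ((ZMod.stdAddChar (N := q)).mulShift a)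
      (map (Int.castRingHom (ZMod q)) F) := by
  have h := sum_Icc_eq_sum_zmod (fun x => (ZMod.stdAddChar (N := q)).mulShift a
    (eval x (map (Int.castRingHom (ZMod q)) F))) (0 : Fin n → ℤ)
  simp only [Pi.zero_apply, zero_add] at h
  rw [gaussSumF, Finset.sum_congr rfl fun y _ => eC_mul_eval_div F a y, h, complSum]
  congr!

theorem norm_gaussSumF_le [NeZero q] (hF : F.IsHomogeneous (k + 1)) {a : ℕ}
    (ha : Nat.gcd a q = 1) :
    ‖gaussSumF n F q a‖ ≤ (q : ℝ) ^ n * polarDensity F k (ZMod q) ^ ((1 : ℝ) / 2 ^ k) := by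
  have hψ : ((ZMod.stdAddChar (N := q)).mulShift (a : ZMod q)).IsPrimitive := by
    intro b hb
    rw [AddChar.mulShift_mulShift]
    refine ZMod.isPrimitive_stdAddChar q ?_
    have hu : IsUnit (a : ZMod q) := (ZMod.isUnit_iff_coprime a q).2 ha
    exact fun h => hb ((hu.mul_right_eq_zero).1 h)
  have hq : (0 : ℝ) < q := by exact_mod_cast Nat.pos_of_ne_zero (NeZero.ne q)
  have h1 : (‖gaussSumF n F q a‖ / (q : ℝ) ^ n) ^ 2 ^ k ≤ polarDensity F k (ZMod q) := by
    rw [gaussSumF_eq_complSum]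
    convert norm_complSum_pow_le_polarDensity hψ hF
    rw [Fintype.card_eq_nat_card]
    simp
  rw [mul_comm, ← div_le_iff₀ (by positivity)]
  calc ‖gaussSumF n F q a‖ / (q : ℝ) ^ n
      = ((‖gaussSumF n F q a‖ / (q : ℝ) ^ n) ^ 2 ^ k) ^ ((1 : ℝ) / 2 ^ k) := by
        rw [← Real.rpow_natCast _ (2 ^ k), ← Real.rpow_mul (by positivity)]
        push_cast
        rw [mul_one_div_cancel (by positivity), Real.rpow_one]
    _ ≤ _ := by gcongr

theorem norm_seriesTerm_le (hF : F.IsHomogeneous (k + 1)) (q : ℕ) :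
    ‖seriesTerm n F q‖ ≤ q * polarDensity F k (ZMod q) ^ ((1 : ℝ) / 2 ^ k) := by
  rw [seriesTerm]
  split_ifs with h0
  · simp [h0]
  have : NeZero q := ⟨h0⟩
  have hq : (0 : ℝ) < q := by exact_mod_cast Nat.pos_of_ne_zero h0
  set r := polarDensity F k (ZMod q) ^ ((1 : ℝ) / 2 ^ k) with hr
  have hr0 : 0 ≤ r := Real.rpow_nonneg (polarDensity_nonneg F k _) _
  rw [norm_mul, norm_inv, norm_pow, Complex.norm_natCast, inv_mul_le_iff₀ (by positivity)]
  calc _ ≤ ∑ a ∈ (Finset.Icc 1 q).filter (fun a => Nat.gcd a q = 1), (q : ℝ) ^ n * r :=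
        norm_sum_le_of_le _ fun a ha => norm_gaussSumF_le hF (Finset.mem_filter.1 ha).2
    _ ≤ ∑ a ∈ Finset.Icc 1 q, (q : ℝ) ^ n * r :=
        Finset.sum_le_sum_of_subset_of_nonneg (Finset.filter_subset _ _)
          fun _ _ _ => by positivity
    _ = _ := by
        rw [Finset.sum_const, Nat.card_Icc, nsmul_eq_mul]
        simp only [add_tsub_cancel_right]
        ring

end GaussSum

section Series

theorem summable_of_coprime_mul {g : ℕ → ℝ} {C u : ℝ} (hu : 1 < u) (hg0 : ∀ q, 0 ≤ g q)
    (hg1 : g 1 = 1) (hmul : ∀ {a b : ℕ}, a.Coprime b → g (a * b) = g a * g b)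
    (hprime : ∀ p : ℕ, p.Prime → g p ≤ C * (p : ℝ) ^ (-u))
    (hpow : ∀ q : ℕ, q ≠ 0 → g q ≤ C * (q : ℝ) ^ (-(u / 2))) : Summable g := by
  have hC : 0 ≤ C := by
    have := hpow 1 one_ne_zero
    rw [hg1] at this
    simp at this
    linarith
  set θ : ℝ := (2 : ℝ) ^ (-(u / 2)) with hθ
  have hθ1 : θ < 1 := Real.rpow_lt_one_of_one_lt_of_neg one_lt_two (by linarith)
  have hr (p : ℕ) (hp : p.Prime) : (p : ℝ) ^ (-(u / 2)) ≤ θ :=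
    Real.rpow_le_rpow_of_nonpos two_pos (by exact_mod_cast hp.two_le) (by linarith)
  have hterm (p : ℕ) (hp : p.Prime) (e : ℕ) : g (p ^ e) ≤ C * ((p : ℝ) ^ (-(u / 2))) ^ e := by
    refine (hpow _ (pow_ne_zero _ hp.ne_zero)).trans (le_of_eq ?_)
    push_cast
    rw [← Real.rpow_natCast, ← Real.rpow_natCast, ← Real.rpow_mul (Nat.cast_nonneg _),
      ← Real.rpow_mul (Nat.cast_nonneg _), mul_comm (e : ℝ)]
  have hgeo (p : ℕ) (hp : p.Prime) : Summable fun e : ℕ => C * ((p : ℝ) ^ (-(u / 2))) ^ e :=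
    (summable_geometric_of_lt_one (by positivity) ((hr p hp).trans_lt hθ1)).mul_left C
  have hsum (p : ℕ) (hp : p.Prime) : Summable fun e : ℕ => g (p ^ e) :=
    (hgeo p hp).of_nonneg_of_le (fun _ => hg0 _) (hterm p hp)
  set D : ℝ := C + C / (1 - θ) with hD
  have hfactor (p : ℕ) (hp : p.Prime) : ∑' e : ℕ, g (p ^ e) ≤ 1 + D * (p : ℝ) ^ (-u) := by
    have hp0 : (0 : ℝ) < p := by exact_mod_cast hp.pos
    have hsq : (p : ℝ) ^ (-u) = ((p : ℝ) ^ (-(u / 2))) ^ 2 := by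
      rw [← Real.rpow_natCast, ← Real.rpow_mul hp0.le]
      congr 1
      push_cast
      ring
    have h2 : ∑' e : ℕ, g (p ^ (e + 2)) ≤ C / (1 - θ) * (p : ℝ) ^ (-u) := by
      have hs2 := (summable_nat_add_iff 2).2 (hgeo p hp)
      refine (((summable_nat_add_iff 2).2 (hsum p hp)).tsum_le_tsum
        (fun e => hterm p hp (e + 2)) hs2).trans ?_
      simp only [pow_add, ← mul_assoc]
      rw [tsum_mul_right, tsum_mul_left, tsum_geometric_of_lt_one (by positivity)
        ((hr p hp).trans_lt hθ1), ← hsq, ← div_eq_mul_inv]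
      have := hr p hp
      have : 0 < 1 - θ := by linarith
      gcongr
    rw [← (hsum p hp).sum_add_tsum_nat_add 2, Finset.sum_range_succ, Finset.sum_range_one,
      pow_zero, pow_one, hg1, hD, add_mul]
    linarith [hprime p hp]
  have hζ : Summable fun p : ℕ => D * (p : ℝ) ^ (-u) :=
    (Real.summable_nat_rpow.2 (by linarith)).mul_left D
  have hD0 : 0 ≤ D := add_nonneg hC (div_nonneg hC (by linarith))
  refine summable_of_sum_range_le (c := g 0 + Real.exp (∑' p : ℕ, D * (p : ℝ) ^ (-u))) hg0 fun N => ?_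
  have hE := EulerProduct.summable_and_hasSum_smoothNumbers_prod_primesBelow_tsum hg1 hmul
    (fun hp => by simpa [abs_of_nonneg (hg0 _)] using hsum _ hp) N
  calc ∑ q ∈ Finset.range N, g q ≤ ∑ q ∈ insert 0 ((Finset.range N).erase 0), g q :=
        Finset.sum_le_sum_of_subset_of_nonneg
          (fun q hq => by by_cases h : q = 0 <;> simp_all) fun _ _ _ => hg0 _
    _ = g 0 + ∑ q ∈ (Finset.range N).erase 0, g q := Finset.sum_insert (by simp)
    _ ≤ g 0 + ∏ p ∈ N.primesBelow, ∑' e : ℕ, g (p ^ e) := by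
        gcongr
        rw [← hE.2.tsum_eq, ← Finset.sum_attach]
        refine (hE.2.summable.sum_le_tsum (((Finset.range N).erase 0).attach.map
          ⟨fun q => (⟨q.1, Nat.mem_smoothNumbers_of_lt ?_ ?_⟩ : N.smoothNumbers), ?_⟩)
          fun _ _ => hg0 _).trans' (le_of_eq ?_)
        · exact Nat.pos_of_ne_zero (Finset.ne_of_mem_erase q.2)
        · exact Finset.mem_range.1 (Finset.mem_of_mem_erase q.2)
        · intro a b h
          exact Subtype.ext (congrArg (fun x : N.smoothNumbers => (x : ℕ)) h)
        · rw [Finset.sum_map]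
          rfl
    _ ≤ g 0 + ∏ p ∈ N.primesBelow, Real.exp (D * (p : ℝ) ^ (-u)) := by
        gcongr with p hp
        · exact fun p _ => tsum_nonneg fun _ => hg0 _
        · refine (hfactor p (Nat.prime_of_mem_primesBelow hp)).trans ?_
          rw [add_comm]
          exact Real.add_one_le_exp _
    _ ≤ _ := by
        rw [← Real.exp_sum]
        gcongr
        exact hζ.sum_le_tsum _ fun _ _ => by positivity

variable {n m σ : ℕ} {F : MvPolynomial (Fin n) ℤ}

theorem polarDensity_zmod_one (F : MvPolynomial (Fin n) ℤ) (k : ℕ) :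
    polarDensity F k (ZMod 1) = 1 := by
  have : Subsingleton (ZMod 1) := inferInstanceAs (Subsingleton (Fin 1))
  rw [polarDensity, Nat.card_congr (Equiv.subtypeUnivEquiv fun _ _ => Subsingleton.elim _ _)]
  simp

/-- The terms of the singular series are summable with a power of the modulus to spare. -/
theorem exists_summable_seriesTerm (hF : F.IsHomogeneous (m + 2))
    (hσ : singDim n ℚ (map (Int.castRingHom ℚ) F) ≤ (σ : ℕ)) (hm : 1 ≤ m)
    (hn : (3 : ℝ) / 2 * (m + 1) < ((n : ℝ) - σ) / 2 ^ (m + 1)) :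
    ∃ η : ℝ, 0 < η ∧ Summable fun q : ℕ => (q : ℝ) ^ η * ‖seriesTerm n F q‖ := by
  set κ : ℝ := ((n : ℝ) - σ) / 2 ^ (m + 1) with hκ
  have hm1 : (1 : ℝ) ≤ m := by exact_mod_cast hm
  have hσn : σ ≤ n := by
    have h1 : 0 < κ := lt_trans (by positivity) hn
    have h2 : (0 : ℝ) < n - σ := by
      rw [hκ] at h1
      exact (div_pos_iff_of_pos_right (by positivity)).1 h1
    exact_mod_cast (sub_pos.1 h2).le
  have hκm : 3 / 2 < κ / (m + 1) := by rwa [lt_div_iff₀ (by positivity)]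
  have hκ3 : 3 < κ := by nlinarith
  set η : ℝ := (κ / (m + 1) - 3 / 2) / 2 with hη
  have hη0 : 0 < η := by linarith
  obtain ⟨C₁, hC₁, h₁⟩ := exists_polarDensity_prime_le hF hσ
  obtain ⟨C₂, hC₂, h₂⟩ := exists_polarDensity_le hF hσ hσn
  set C := max C₁ C₂ with hC
  have hC0 : 0 < C := lt_max_of_lt_left hC₁
  set s : ℝ := (1 : ℝ) / 2 ^ (m + 1) with hs
  have hs0 : 0 < s := by positivity
  set ρ : ℕ → ℝ := fun q => polarDensity F (m + 1) (ZMod q) with hρ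
  have hρ0 (q : ℕ) : 0 ≤ ρ q := polarDensity_nonneg F _ _
  have key (q : ℕ) (hq : q ≠ 0) {t : ℝ} (h : ρ q ≤ C * (q : ℝ) ^ (-t)) :
      (q : ℝ) ^ (1 + η) * ρ q ^ s ≤ C ^ s * (q : ℝ) ^ (-(t * s - 1 - η)) := by
    have hq0 : (0 : ℝ) < q := by positivity
    calc (q : ℝ) ^ (1 + η) * ρ q ^ s ≤ (q : ℝ) ^ (1 + η) * (C * (q : ℝ) ^ (-t)) ^ s := by
          gcongr
          exact hρ0 q
      _ = _ := by
          rw [Real.mul_rpow hC0.le (by positivity), ← Real.rpow_mul hq0.le, mul_left_comm,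
            ← Real.rpow_add hq0]
          congr 2
          ring
  set u : ℝ := min (κ - 1 - η) (2 * (κ / (m + 1) - 1 - η)) with hu
  have hu1 : 1 < u := by
    refine lt_min ?_ ?_
    · have : κ / (m + 1) ≤ κ / 2 := by gcongr; linarith
      linarith
    · linarith
  have hsummable : Summable fun q : ℕ => (q : ℝ) ^ (1 + η) * ρ q ^ s := by
    refine summable_of_coprime_mul (C := C ^ s) hu1 (fun q => ?_) ?_ ?_ ?_ ?_
    · have := hρ0 q
      positivity
    · simp [hρ, polarDensity_zmod_one]
    · intro a b hab
      simp only [hρ]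
      rw [polarDensity_zmod_mul F _ hab, Real.mul_rpow (hρ0 a) (hρ0 b), Nat.cast_mul,
        Real.mul_rpow (Nat.cast_nonneg a) (Nat.cast_nonneg b)]
      ring
    · intro p hp
      refine (key p hp.ne_zero ((h₁ p hp).trans (by gcongr; exact le_max_left _ _))).trans ?_
      gcongr
      · exact_mod_cast hp.one_le
      · rw [hs, mul_one_div]
        exact min_le_left _ _
    · intro q hq
      refine (key q hq ((h₂ q hq).trans (by gcongr; exact le_max_right _ _))).trans ?_
      gcongr
      · exact_mod_cast Nat.pos_of_ne_zero hq
      · have h3 : ((n : ℝ) - σ) / (m + 1) * s = κ / (m + 1) := by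
          rw [hs, hκ]
          field_simp
        rw [h3]
        have := min_le_right (κ - 1 - η) (2 * (κ / (m + 1) - 1 - η))
        linarith
  refine ⟨η, hη0, hsummable.of_nonneg_of_le (fun q => by positivity) fun q => ?_⟩
  rcases eq_or_ne q 0 with rfl | hq
  · have h0 : seriesTerm n F 0 = 0 := by simp [seriesTerm]
    rw [h0]
    have := hρ0 0
    simp only [norm_zero, mul_zero]
    positivity
  · have hq0 : (0 : ℝ) < q := by positivity
    rw [add_comm, Real.rpow_add hq0, Real.rpow_one, mul_assoc]
    gcongr
    exact norm_seriesTerm_le hF q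

end Series

theorem norm_eC (t : ℝ) : ‖eC t‖ = 1 := by
  have h : (2 * Real.pi * Complex.I * t : ℂ) = ((2 * Real.pi * t : ℝ) : ℂ) * Complex.I := by
    push_cast
    ring
  rw [eC, h, Complex.norm_exp_ofReal_mul_I]

theorem contDiff_eC : ContDiff ℝ (⊤ : ℕ∞) eC :=
  (contDiff_const.mul Complex.ofRealCLM.contDiff).cexp

theorem hasDerivAt_eC (t : ℝ) : HasDerivAt eC (2 * Real.pi * Complex.I * eC t) t := by
  have h := ((hasDerivAt_id (t : ℂ)).const_mul (2 * Real.pi * Complex.I)).cexp.comp_ofReal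
  rw [id, mul_one, mul_comm (Complex.exp _)] at h
  exact h

theorem eC_add (s t : ℝ) : eC (s + t) = eC s * eC t := by
  simp only [eC]
  rw [← Complex.exp_add]
  congr 1
  push_cast
  ring

theorem eC_intCast (k : ℤ) : eC k = 1 := by
  rw [eC, Complex.exp_eq_one_iff]
  exact ⟨k, by push_cast; ring⟩

section Oscillatory

theorem norm_integral_mul_eC_le {E : Type*} [MeasurableSpace E] {μ : Measure E} {f : E → ℝ} (u : E → ℂ) (γ : ℝ) :
    ‖∫ x, u x * eC (γ * f x) ∂μ‖ ≤ ∫ x, ‖u x‖ ∂μ := by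
  refine (norm_integral_le_integral_norm _).trans (le_of_eq ?_)
  simp [norm_eC]

theorem continuous_integral_mul_eC {E : Type*} [TopologicalSpace E] [MeasurableSpace E]
    [OpensMeasurableSpace E] [SecondCountableTopologyEither E ℂ] {μ : Measure E}
    [IsFiniteMeasureOnCompacts μ] {f : E → ℝ} (hf : Continuous f) {u : E → ℂ} (hu : Continuous u)
    (hus : HasCompactSupport u) : Continuous fun γ : ℝ => ∫ x, u x * eC (γ * f x) ∂μ := by
  refine continuous_of_dominated (bound := fun x => ‖u x‖) (fun γ => ?_) (fun γ => ?_)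
    (hu.integrable_of_hasCompactSupport hus).norm (Filter.Eventually.of_forall fun x => ?_)
  · exact (hu.mul (contDiff_eC.continuous.comp (continuous_const.mul hf))).aestronglyMeasurable
  · exact Filter.Eventually.of_forall fun x => by simp [norm_eC]
  · exact continuous_const.mul (contDiff_eC.continuous.comp (continuous_id.mul continuous_const))

variable {E : Type*} [NormedAddCommGroup E] [NormedSpace ℝ E] [FiniteDimensional ℝ E]
  [MeasurableSpace E] [BorelSpace E] {μ : Measure E} [μ.IsAddHaarMeasure] {f : E → ℝ} {v : E}

/-- Integration by parts against the phase `γ f`, in a direction in which `f` has no critical point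
on the support of the amplitude. -/
theorem exists_integral_mul_eC_eq (hf : ContDiff ℝ (⊤ : ℕ∞) f) {u : E → ℂ}
    (hu : ContDiff ℝ (⊤ : ℕ∞) u) (hus : HasCompactSupport u)
    (hv : ∀ x ∈ tsupport u, fderiv ℝ f x v ≠ 0) :
    ∃ w : E → ℂ, ContDiff ℝ (⊤ : ℕ∞) w ∧ HasCompactSupport w ∧
      (∀ x ∈ tsupport w, fderiv ℝ f x v ≠ 0) ∧
      ∀ γ : ℝ, (2 * Real.pi * Complex.I * γ) * ∫ x, u x * eC (γ * f x) ∂μ =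
        -∫ x, w x * eC (γ * f x) ∂μ := by
  have hg : ContDiff ℝ (⊤ : ℕ∞) fun x => ((fderiv ℝ f x v : ℝ) : ℂ) :=
    Complex.ofRealCLM.contDiff.comp ((hf.fderiv_right (by simp)).clm_apply contDiff_const)
  set h : E → ℂ := fun x => u x * ((fderiv ℝ f x v : ℝ) : ℂ)⁻¹ with hh
  have hhsub : Function.support h ⊆ Function.support u := fun x hx hux => hx (by simp [hh, hux])
  have hts : tsupport h ⊆ tsupport u := closure_mono hhsub
  have hhs : HasCompactSupport h := hus.mono hhsub
  have hhc : ContDiff ℝ (⊤ : ℕ∞) h := 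
    contMDiff_iff_contDiff.1 <| contMDiff_of_tsupport fun x hx => contMDiffAt_iff_contDiffAt.2 <|
      hu.contDiffAt.mul (hg.contDiffAt.inv (Complex.ofReal_ne_zero.2 (hv x (hts hx))))
  have hw : ContDiff ℝ (⊤ : ℕ∞) fun x => fderiv ℝ h x v :=
    (hhc.fderiv_right (by simp)).clm_apply contDiff_const
  have hws : HasCompactSupport fun x => fderiv ℝ h x v := hhs.fderiv_apply ℝ v
  refine ⟨fun x => fderiv ℝ h x v, hw, hws,
    fun x hx => hv x (hts (tsupport_fderiv_apply_subset ℝ v hx)), fun γ => ?_⟩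
  have he : ContDiff ℝ (⊤ : ℕ∞) fun x => eC (γ * f x) :=
    contDiff_eC.comp (contDiff_const.mul hf)
  have hde (x : E) : fderiv ℝ (fun x => eC (γ * f x)) x v =
      2 * Real.pi * Complex.I * γ * (fderiv ℝ f x v : ℝ) * eC (γ * f x) := by
    have h1 : HasFDerivAt f (fderiv ℝ f x) x :=
      ((hf.differentiable (by simp)) x).hasFDerivAt
    have h2 := (hasDerivAt_eC (γ * f x)).hasFDerivAt.comp x (h1.const_mul γ)
    have h3 : fderiv ℝ (fun x => eC (γ * f x)) x = _ := h2.fderiv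
    rw [h3]
    simp
    ring
  have hde' : Continuous fun x => fderiv ℝ (fun x => eC (γ * f x)) x v :=
    ((he.fderiv_right (m := (⊤ : ℕ∞)) (by simp)).clm_apply contDiff_const).continuous
  have hibp := integral_mul_fderiv_eq_neg_fderiv_mul_of_integrable (μ := μ) (f := h)
    (g := fun x => eC (γ * f x)) (v := v)
    ((hw.continuous.mul he.continuous).integrable_of_hasCompactSupport hws.mul_right)
    ((hhc.continuous.mul hde').integrable_of_hasCompactSupport hhs.mul_right)
    ((hhc.continuous.mul he.continuous).integrable_of_hasCompactSupport hhs.mul_right)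
    (fun x _ => (hhc.differentiable (by simp)) x) (fun x _ => (he.differentiable (by simp)) x)
  rw [← hibp, ← integral_const_mul]
  refine integral_congr_ae (Filter.Eventually.of_forall fun x => ?_)
  dsimp only
  rw [hde]
  by_cases hx : u x = 0
  · simp [hh, hx]
  · have : ((fderiv ℝ f x v : ℝ) : ℂ) ≠ 0 := by exact_mod_cast hv x (subset_tsupport u hx)
    simp only [hh]
    field_simp

theorem exists_norm_integral_mul_eC_le (hf : ContDiff ℝ (⊤ : ℕ∞) f) {u : E → ℂ}
    (hu : ContDiff ℝ (⊤ : ℕ∞) u) (hus : HasCompactSupport u)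
    (hv : ∀ x ∈ tsupport u, fderiv ℝ f x v ≠ 0) :
    ∃ C : ℝ, 0 < C ∧ ∀ γ : ℝ, ‖∫ x, u x * eC (γ * f x) ∂μ‖ ≤ C * (1 + |γ|) ^ (-2 : ℝ) := by
  obtain ⟨w₁, hw₁, hs₁, hv₁, h₁⟩ := exists_integral_mul_eC_eq (μ := μ) hf hu hus hv
  obtain ⟨w₂, hw₂, hs₂, hv₂, h₂⟩ := exists_integral_mul_eC_eq (μ := μ) hf hw₁ hs₁ hv₁
  set A := ∫ x, ‖u x‖ ∂μ
  set B := ∫ x, ‖w₂ x‖ ∂μ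
  have hA : 0 ≤ A := integral_nonneg fun _ => norm_nonneg _
  have hB : 0 ≤ B := integral_nonneg fun _ => norm_nonneg _
  refine ⟨2 * A + 2 * B + 1, by positivity, fun γ => ?_⟩
  rw [Real.rpow_neg (by positivity), ← div_eq_mul_inv, le_div_iff₀ (by positivity),
    show (2 : ℝ) = ((2 : ℕ) : ℝ) by norm_num, Real.rpow_natCast]
  set J := ‖∫ x, u x * eC (γ * f x) ∂μ‖ with hJ
  have hJA : J ≤ A := norm_integral_mul_eC_le u γ
  have hJB : (2 * Real.pi * |γ|) ^ 2 * J ≤ B := by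
    have e : (2 * Real.pi * Complex.I * γ) ^ 2 * ∫ x, u x * eC (γ * f x) ∂μ =
        ∫ x, w₂ x * eC (γ * f x) ∂μ := by
      rw [sq, mul_assoc, h₁, mul_neg, h₂, neg_neg]
    have e' := congrArg norm e
    rw [norm_mul, norm_pow] at e'
    simp only [norm_mul, Complex.norm_real, Complex.norm_I, Complex.norm_ofNat, mul_one,
      Real.norm_eq_abs, abs_of_pos Real.pi_pos] at e'
    rw [hJ, e']
    exact norm_integral_mul_eC_le w₂ γ
  have hJ0 : 0 ≤ J := norm_nonneg _
  have hpi : 1 ≤ 2 * Real.pi := by linarith [Real.pi_gt_three]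
  have h5 : |γ| ^ 2 * J ≤ B := by
    refine le_trans ?_ hJB
    gcongr
    exact le_mul_of_one_le_left (abs_nonneg γ) hpi
  have h6 : (1 + |γ|) ^ 2 ≤ 2 + 2 * |γ| ^ 2 := by nlinarith [sq_nonneg (1 - |γ|)]
  push_cast
  nlinarith [mul_le_mul_of_nonneg_left h6 hJ0]

end Oscillatory

section Weight

variable {n : ℕ}

theorem contDiff_eval_real {k : WithTop ℕ∞} (G : MvPolynomial (Fin n) ℝ) :
    ContDiff ℝ k fun x : Fin n → ℝ => eval x G := by
  induction G using MvPolynomial.induction_on with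
  | C a => simpa using contDiff_const
  | add p q hp hq => simpa using hp.add hq
  | mul_X p i hp => simpa using hp.mul (contDiff_apply ℝ ℝ i)

theorem fderiv_eval_single (G : MvPolynomial (Fin n) ℝ) (x : Fin n → ℝ) (i : Fin n) :
    fderiv ℝ (fun x : Fin n → ℝ => eval x G) x (Pi.single i 1) = eval x (pderiv i G) := by
  have hd (G : MvPolynomial (Fin n) ℝ) : DifferentiableAt ℝ (fun x => eval x G) x :=
    (contDiff_eval_real (k := 1) G).differentiable (by simp) x
  induction G using MvPolynomial.induction_on with
  | C a => simp
  | add p q hp hq =>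
    simp only [map_add]
    rw [fderiv_fun_add (hd p) (hd q), add_apply, hp, hq]
  | mul_X p j hp =>
    simp only [map_mul, eval_X, Derivation.leibniz, map_add, smul_eq_mul]
    rw [fderiv_fun_mul (hd p) (differentiableAt_apply j x)]
    simp only [add_apply, smul_apply, smul_eq_mul, hp]
    rw [(hasFDerivAt_apply (𝕜 := ℝ) j x).fderiv, pderiv_X]
    simp only [ContinuousLinearMap.proj_apply, Pi.single_apply]
    split_ifs <;> simp_all

theorem omegaMaj_eq (x₀ : Fin n → ℝ) {δ : ℝ} (x : Fin n → ℝ) :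
    omegaMaj n x₀ δ x = expNegInvGlue (1 - δ⁻¹ ^ 2 * ∑ i, (x i - x₀ i) ^ 2) := by
  have h : δ⁻¹ ^ 2 * ∑ i, (x i - x₀ i) ^ 2 = (δ⁻¹ * √(∑ i, (x i - x₀ i) ^ 2)) ^ 2 := by
    rw [mul_pow, Real.sq_sqrt (Finset.sum_nonneg fun _ _ => sq_nonneg _)]
  rw [omegaMaj, h, wBump, expNegInvGlue]
  set y := δ⁻¹ * √(∑ i, (x i - x₀ i) ^ 2)
  have hy : 1 - y ^ 2 ≤ 0 ↔ ¬|y| < 1 := by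
    rw [not_lt, sub_nonpos, one_le_sq_iff_one_le_abs]
  by_cases h : |y| < 1 <;> simp [hy, h]

theorem contDiff_omegaMaj (x₀ : Fin n → ℝ) (δ : ℝ) : ContDiff ℝ (⊤ : ℕ∞) (omegaMaj n x₀ δ) := by
  rw [_root_.funext (omegaMaj_eq x₀)]
  refine expNegInvGlue.contDiff.comp (contDiff_const.sub (contDiff_const.mul ?_))
  exact ContDiff.sum fun i _ => ((contDiff_apply ℝ ℝ i).sub contDiff_const).pow 2

theorem tsupport_omegaMaj_subset (x₀ : Fin n → ℝ) {δ : ℝ} (hδ : 0 < δ) :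
    tsupport (omegaMaj n x₀ δ) ⊆ Metric.closedBall x₀ δ := by
  refine closure_minimal (fun x hx => ?_) Metric.isClosed_closedBall
  rw [Function.mem_support, omegaMaj_eq] at hx
  have h1 : ¬1 - δ⁻¹ ^ 2 * ∑ i, (x i - x₀ i) ^ 2 ≤ 0 :=
    fun h => hx (expNegInvGlue.zero_of_nonpos h)
  rw [not_le, sub_pos, inv_pow, inv_mul_lt_iff₀ (by positivity), mul_one] at h1
  rw [Metric.mem_closedBall, dist_pi_le_iff hδ.le]
  intro i
  rw [Real.dist_eq]
  refine abs_le_of_sq_le_sq (le_trans ?_ h1.le) hδ.le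
  exact Finset.single_le_sum (f := fun i => (x i - x₀ i) ^ 2) (fun _ _ => sq_nonneg _)
    (Finset.mem_univ i)

theorem hasCompactSupport_omegaMaj (x₀ : Fin n → ℝ) {δ : ℝ} (hδ : 0 < δ) :
    HasCompactSupport (omegaMaj n x₀ δ) :=
  HasCompactSupport.intro' (isCompact_closedBall x₀ δ) Metric.isClosed_closedBall fun _ hx =>
    image_eq_zero_of_notMem_tsupport fun h => hx (tsupport_omegaMaj_subset x₀ hδ h)

end Weight

section SingularIntegral

variable {n : ℕ} {ω : (Fin n → ℝ) → ℝ}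

theorem continuous_singInt (F : MvPolynomial (Fin n) ℤ) (hω : Continuous ω)
    (hωs : HasCompactSupport ω) : Continuous (singInt n F ω) :=
  continuous_integral_mul_eC (contDiff_eval_real (k := 0) _).continuous
    (Complex.continuous_ofReal.comp hω) (hωs.comp_left Complex.ofReal_zero)

theorem exists_norm_singInt_le (F : MvPolynomial (Fin n) ℤ) (hω : ContDiff ℝ (⊤ : ℕ∞) ω)
    (hωs : HasCompactSupport ω) (i : Fin n)
    (hi : ∀ x ∈ tsupport ω, eval x (pderiv i (map (Int.castRingHom ℝ) F)) ≠ 0) :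
    ∃ C : ℝ, 0 < C ∧ ∀ γ : ℝ, ‖singInt n F ω γ‖ ≤ C * (1 + |γ|) ^ (-2 : ℝ) := by
  refine exists_norm_integral_mul_eC_le (v := Pi.single i 1) (contDiff_eval_real _)
    (Complex.ofRealCLM.contDiff.comp hω) (hωs.comp_left Complex.ofReal_zero) fun x hx => ?_
  rw [fderiv_eval_single]
  exact hi x (closure_mono (Function.support_comp_subset Complex.ofReal_zero ω) hx)

theorem integrable_rpow_mul_norm_singInt {F : MvPolynomial (Fin n) ℤ} (hc : Continuous (singInt n F ω))
    {C : ℝ} (hC : ∀ γ : ℝ, ‖singInt n F ω γ‖ ≤ C * (1 + |γ|) ^ (-2 : ℝ)) {s : ℝ} (hs0 : 0 ≤ s)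
    (hs1 : s < 1) : Integrable fun γ : ℝ => |γ| ^ s * ‖singInt n F ω γ‖ := by
  have h : Integrable fun γ : ℝ => C * (1 + ‖γ‖) ^ (-(2 - s)) :=
    (integrable_one_add_norm (by simp; linarith)).const_mul C
  refine h.mono' ((continuous_abs.rpow_const fun _ => Or.inr hs0).mul hc.norm).aestronglyMeasurable
    (Filter.Eventually.of_forall fun γ => ?_)
  rw [Real.norm_of_nonneg (by positivity), Real.norm_eq_abs]
  have h0 : 0 < 1 + |γ| := by positivity
  calc |γ| ^ s * ‖singInt n F ω γ‖ ≤ (1 + |γ|) ^ s * (C * (1 + |γ|) ^ (-2 : ℝ)) := by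
        gcongr
        · linarith
        · exact hC γ
    _ = _ := by
        rw [mul_left_comm, ← Real.rpow_add h0]
        congr 2
        ring

theorem exists_closedBall_ne_zero (G : MvPolynomial (Fin n) ℝ) {x₀ : Fin n → ℝ}
    (h : eval x₀ G ≠ 0) :
    ∃ δ₀ : ℝ, 0 < δ₀ ∧ δ₀ ≤ 1 ∧ ∀ x ∈ Metric.closedBall x₀ δ₀, eval x G ≠ 0 := by
  have hc : Continuous fun x : Fin n → ℝ => eval x G := (contDiff_eval_real (k := 0) G).continuous
  obtain ⟨ε, hε, hball⟩ := Metric.nhds_basis_closedBall.mem_iff.1 (hc.continuousAt.eventually_ne h)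
  exact ⟨min ε 1, lt_min hε one_pos, min_le_right _ _, fun x hx =>
    hball (Metric.closedBall_subset_closedBall (min_le_left _ _) hx)⟩

end SingularIntegral

section RiemannSum

variable {n q : ℕ}

/-- Comparison of a sum against a function of the residue class modulo `q` with an integral. -/
theorem norm_tsum_sub_integral_le [NeZero q] {χ : (Fin n → ZMod q) → ℂ} (hχ : ∀ x, ‖χ x‖ ≤ 1)
    {G : (Fin n → ℝ) → ℂ} {Λ ρ P : ℝ} (hΛ : 0 ≤ Λ) (hG : ∀ u v, ‖G u - G v‖ ≤ Λ * ‖u - v‖)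
    (hρ : 0 ≤ ρ) (hsupp : ∀ u, ρ < ‖u‖ → G u = 0) (hP : 1 ≤ P) (hqP : (q : ℝ) ≤ P) :
    ‖(∑' x : Fin n → ℤ, χ (fun i => x i) * G fun i => x i / P) -
      ((P / q) ^ n : ℝ) * ((∑ x, χ x) * ∫ u, G u)‖ ≤ ((2 * ρ + 5) * P) ^ n * (Λ * (q / P)) := by
  have hP0 : 0 < P := one_pos.trans_le hP
  have hq0 : (0 : ℝ) < q := by exact_mod_cast Nat.pos_of_ne_zero (NeZero.ne q)
  have hGc : Continuous G := (LipschitzWith.of_dist_le_mul (K := ⟨Λ, hΛ⟩) fun u v => by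
    rw [dist_eq_norm, dist_eq_norm]
    exact hG u v).continuous
  have hGs : HasCompactSupport G :=
    HasCompactSupport.intro (isCompact_closedBall 0 ρ) fun u hu => hsupp u (by simpa using hu)
  have hGi : Integrable G := hGc.integrable_of_hasCompactSupport hGs
  set B : ℤ := ⌈(ρ + 1) * P⌉ with hB
  have hB1 : (ρ + 1) * P ≤ B := Int.le_ceil _
  have hB2 : (B : ℝ) < (ρ + 1) * P + 1 := Int.ceil_lt_add_one _
  set box : Finset (Fin n → ℤ) := Finset.Icc (fun _ => -B) (fun _ => B) with hbox
  have hcard : (box.card : ℝ) ≤ ((2 * ρ + 5) * P) ^ n := by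
    have hB0 : 0 ≤ B := by
      have : (0 : ℝ) ≤ B := le_trans (by positivity) hB1
      exact_mod_cast this
    have h1 : (box.card : ℝ) = (((B + 1 - -B).toNat : ℕ) : ℝ) ^ n := by
      rw [hbox, Pi.card_Icc]
      simp
    have h2 : (((B + 1 - -B).toNat : ℕ) : ℝ) = 2 * B + 1 := by
      have : (((B + 1 - -B).toNat : ℕ) : ℤ) = 2 * B + 1 := by omega
      exact_mod_cast this
    rw [h1, h2]
    have : (0 : ℝ) ≤ B := by exact_mod_cast hB0
    gcongr
    nlinarith
  set Q : (Fin n → ℤ) → Set (Fin n → ℝ) :=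
    fun x => Set.univ.pi fun i => Set.Ioc ((x i - q) / P) (x i / P) with hQ
  have hQm (x) : MeasurableSet (Q x) := MeasurableSet.univ_pi fun _ => measurableSet_Ioc
  have hQv (x) : volume (Q x) = ENNReal.ofReal ((q / P) ^ n) := by
    rw [hQ, Real.volume_pi_Ioc, ENNReal.ofReal_pow (by positivity)]
    simp [← sub_div]
  have hQr (x) : volume.real (Q x) = (q / P) ^ n := by
    rw [measureReal_def, hQv, ENNReal.toReal_ofReal (by positivity)]
  have hQmem (x : Fin n → ℤ) (u : Fin n → ℝ) : u ∈ Q x ↔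
      x ∈ Finset.Icc (fun i => ⌈P * u i⌉) (fun i => ⌈P * u i⌉ + (q - 1)) := by
    simp only [hQ, Set.mem_pi, Set.mem_univ, true_imp_iff, Set.mem_Ioc, Finset.mem_Icc,
      Pi.le_def, ← forall_and]
    refine forall_congr' fun i => ?_
    rw [div_lt_iff₀ hP0, le_div_iff₀ hP0, Int.ceil_le, mul_comm (u i), and_comm]
    refine and_congr_right fun _ => ?_
    have h3 : x i ≤ ⌈P * u i⌉ + (q - 1) ↔ x i - q < ⌈P * u i⌉ := by omega
    rw [h3, Int.lt_ceil]
    push_cast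
    rfl
  have hbox_of_mem (x : Fin n → ℤ) (u : Fin n → ℝ) (hu : u ∈ Q x) (hGu : G u ≠ 0) : x ∈ box := by
    have hu' : ‖u‖ ≤ ρ := not_lt.1 fun h => hGu (hsupp u h)
    simp only [hQ, Set.mem_pi, Set.mem_univ, true_imp_iff, Set.mem_Ioc] at hu
    rw [hbox, Finset.mem_Icc]
    have hx (i : Fin n) : |(x i : ℝ)| ≤ B := by
      have h1 := (norm_le_pi_norm u i).trans hu'
      rw [Real.norm_eq_abs, abs_le] at h1
      have h2 := hu i
      rw [div_lt_iff₀ hP0, le_div_iff₀ hP0] at h2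
      rw [abs_le]
      constructor <;> nlinarith
    exact ⟨fun i => by exact_mod_cast (abs_le.1 (hx i)).1,
      fun i => by exact_mod_cast (abs_le.1 (hx i)).2⟩
  have hsum : ∑' x : Fin n → ℤ, χ (fun i => x i) * G (fun i => x i / P) =
      ∑ x ∈ box, χ (fun i => x i) * G (fun i => x i / P) := by
    refine tsum_eq_sum fun x hx => ?_
    have hmem : (fun i => (x i : ℝ) / P) ∈ Q x := by
      simp only [hQ, Set.mem_pi, Set.mem_univ, true_imp_iff, Set.mem_Ioc, le_refl, and_true]
      intro i
      gcongr
      linarith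
    rw [not_not.1 fun h => hx (hbox_of_mem x _ hmem h), mul_zero]
  have hpt (u : Fin n → ℝ) : (∑ x, χ x) * G u =
      ∑ x ∈ box, (Q x).indicator (fun u => χ (fun i => x i) * G u) u := by
    by_cases hu : G u = 0
    · simp [Set.indicator_apply, hu]
    · simp only [Set.indicator_apply]
      rw [← Finset.sum_filter, ← Finset.sum_mul, ← sum_Icc_eq_sum_zmod χ fun i => ⌈P * u i⌉]
      congr 1
      refine Finset.sum_congr ?_ fun _ _ => rfl
      ext x
      rw [Finset.mem_filter, ← hQmem]
      exact ⟨fun h => ⟨hbox_of_mem x u h hu, h⟩, fun h => h.2⟩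
  have hint1 : (∑ x, χ x) * ∫ u, G u = ∑ x ∈ box, ∫ u in Q x, χ (fun i => x i) * G u := by
    rw [← integral_const_mul, integral_congr_ae (Filter.Eventually.of_forall hpt),
      integral_finsetSum _ fun x _ => (hGi.const_mul _).indicator (hQm x)]
    exact Finset.sum_congr rfl fun x _ => integral_indicator (hQm x)
  have hint2 : ((q / P) ^ n : ℝ) * ∑' x : Fin n → ℤ, χ (fun i => x i) * G (fun i => x i / P) =
      ∑ x ∈ box, ∫ _ in Q x, χ (fun i => x i) * G (fun i => x i / P) := by
    rw [hsum, Finset.mul_sum]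
    refine Finset.sum_congr rfl fun x _ => ?_
    rw [setIntegral_const, hQr, Complex.real_smul]
  have hdiff : ‖((q / P) ^ n : ℝ) * (∑' x : Fin n → ℤ, χ (fun i => x i) * G fun i => x i / P) -
      (∑ x, χ x) * ∫ u, G u‖ ≤ box.card * ((q / P) ^ n * (Λ * (q / P))) := by
    rw [hint1, hint2, ← Finset.sum_sub_distrib, ← nsmul_eq_mul, ← Finset.sum_const]
    refine norm_sum_le_of_le _ fun x _ => ?_
    have hfin : volume (Q x) < ⊤ := by rw [hQv]; exact ENNReal.ofReal_lt_top
    have hci : IntegrableOn (fun _ => χ (fun i => x i) * G (fun i => x i / P)) (Q x) :=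
      integrableOn_const hfin.ne enorm_ne_top
    rw [← integral_sub hci (hGi.const_mul _).integrableOn, mul_comm (_ ^ n),
      ← hQr x]
    refine norm_setIntegral_le_of_norm_le_const hfin fun u hu => ?_
    rw [← mul_sub, norm_mul]
    refine (mul_le_of_le_one_left (norm_nonneg _) (hχ _)).trans ((hG _ _).trans ?_)
    gcongr
    rw [pi_norm_le_iff_of_nonneg (by positivity)]
    intro i
    have hu' := hu i (Set.mem_univ i)
    rw [Set.mem_Ioc, sub_div] at hu'
    rw [Pi.sub_apply, Real.norm_eq_abs, abs_le]
    constructor <;> linarith [div_nonneg hq0.le hP0.le]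
  have hinv : (((P / q) ^ n : ℝ) : ℂ) * ((q / P) ^ n : ℝ) = 1 := by
    rw [← Complex.ofReal_mul, ← mul_pow, div_mul_div_cancel₀ hq0.ne', div_self hP0.ne', one_pow,
      Complex.ofReal_one]
  calc _ = ‖(((P / q) ^ n : ℝ) : ℂ) * (((q / P) ^ n : ℝ) *
        (∑' x : Fin n → ℤ, χ (fun i => x i) * G fun i => x i / P) -
          (∑ x, χ x) * ∫ u, G u)‖ := by 
        congr 1
        linear_combination (-(∑' x : Fin n → ℤ, χ (fun i => x i) * G fun i => x i / P)) * hinv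
    _ = (P / q) ^ n * ‖((q / P) ^ n : ℝ) *
        (∑' x : Fin n → ℤ, χ (fun i => x i) * G fun i => x i / P) -
          (∑ x, χ x) * ∫ u, G u‖ := by
        rw [norm_mul, Complex.norm_real, Real.norm_of_nonneg (by positivity)]
    _ ≤ (P / q) ^ n * (box.card * ((q / P) ^ n * (Λ * (q / P)))) := by gcongr
    _ = box.card * (Λ * (q / P)) := by
        rw [div_pow, div_pow]
        field_simp
    _ ≤ _ := by gcongr

end RiemannSum

section MajorArcApproximation

theorem exists_norm_mul_eC_sub_le {E : Type*} [NormedAddCommGroup E] [NormedSpace ℝ E]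
    {u : E → ℝ} {f : E → ℝ} (hu : ContDiff ℝ 1 u) (hus : HasCompactSupport u)
    (hf : ContDiff ℝ 1 f) :
    ∃ L : ℝ, 0 < L ∧ ∀ (γ : ℝ) (x y : E),
      ‖(u x : ℂ) * eC (γ * f x) - u y * eC (γ * f y)‖ ≤ L * (1 + |γ|) * ‖x - y‖ := by
  obtain ⟨A, hA⟩ :=
    (hus.fderiv (𝕜 := ℝ)).exists_bound_of_continuous (hu.continuous_fderiv one_ne_zero)
  obtain ⟨B, hB⟩ := (hus.smul_right (f' := fderiv ℝ f)).exists_bound_of_continuous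
    (hu.continuous.smul (hf.continuous_fderiv one_ne_zero))
  have hA0 : 0 ≤ A := (norm_nonneg _).trans (hA 0)
  have hB0 : 0 ≤ B := (norm_nonneg _).trans (hB 0)
  have hπ : 0 ≤ 2 * Real.pi * B := by positivity
  refine ⟨A + 2 * Real.pi * B + 1, by positivity, fun γ x y => ?_⟩
  have hd (z : E) : HasFDerivAt (fun z => (u z : ℂ) * eC (γ * f z))
      ((u z : ℂ) • ((γ • fderiv ℝ f z).smulRight (2 * Real.pi * Complex.I * eC (γ * f z))) +
        eC (γ * f z) • (Complex.ofRealCLM.comp (fderiv ℝ u z))) z := by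
    have h1 : HasFDerivAt (fun z => (u z : ℂ)) (Complex.ofRealCLM.comp (fderiv ℝ u z)) z :=
      Complex.ofRealCLM.hasFDerivAt.comp z (hu.differentiable one_ne_zero z).hasFDerivAt
    have h2 : HasFDerivAt (fun z => eC (γ * f z))
        ((γ • fderiv ℝ f z).smulRight (2 * Real.pi * Complex.I * eC (γ * f z))) z :=
      (HasFDerivAt.comp (g := eC) z (hasDerivAt_eC (γ * f z)).hasFDerivAt
        ((hf.differentiable one_ne_zero z).hasFDerivAt.const_mul γ)).congr_fderiv (by ext; simp [mul_assoc])
    exact h1.mul h2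
  refine Convex.norm_image_sub_le_of_norm_hasFDerivWithin_le
    (fun z _ => (hd z).hasFDerivWithinAt) (fun z _ => ?_) convex_univ (Set.mem_univ y)
    (Set.mem_univ x)
  have h1 : ‖(u z : ℂ) • ((γ • fderiv ℝ f z).smulRight (2 * Real.pi * Complex.I * eC (γ * f z)))‖ ≤
      2 * Real.pi * B * |γ| := by
    have := hB z
    rw [Pi.smul_apply', norm_smul] at this
    rw [norm_smul, ContinuousLinearMap.norm_smulRight_apply, norm_smul]
    simp only [norm_mul, norm_eC, Complex.norm_I, Complex.norm_real, Complex.norm_ofNat,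
      Real.norm_eq_abs, abs_of_pos Real.pi_pos, mul_one] at this ⊢
    calc _ = 2 * Real.pi * (|u z| * ‖fderiv ℝ f z‖) * |γ| := by ring
      _ ≤ _ := by gcongr
  have h2 : ‖eC (γ * f z) • (Complex.ofRealCLM.comp (fderiv ℝ u z))‖ ≤ A := by
    rw [norm_smul, norm_eC, one_mul]
    refine (ContinuousLinearMap.opNorm_comp_le _ _).trans ?_
    rw [Complex.ofRealCLM_norm, one_mul]
    exact hA z
  refine (norm_add_le _ _).trans ((add_le_add h1 h2).trans ?_)
  nlinarith [abs_nonneg γ, mul_nonneg hA0 (abs_nonneg γ)]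

variable {n d : ℕ} {F : MvPolynomial (Fin n) ℤ} {ω : (Fin n → ℝ) → ℝ}

theorem eval_mul_of_isHomogeneous {R : Type*} [CommSemiring R] {G : MvPolynomial (Fin n) R}
    (hG : G.IsHomogeneous d) (c : R) (x : Fin n → R) :
    eval (fun i => c * x i) G = c ^ d * eval x G := by
  rw [eval_eq', eval_eq', Finset.mul_sum]
  refine Finset.sum_congr rfl fun s hs => ?_
  have hs' : ∑ i, s i = d := by
    rw [← hG (mem_support_iff.1 hs), Finsupp.weight_apply, Finsupp.sum_fintype _ _ (by simp)]
    simp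
  simp only [mul_pow]
  rw [Finset.prod_mul_distrib, Finset.prod_pow_eq_pow_sum, hs']
  ring

theorem exists_norm_expSum_sub_le (hF : F.IsHomogeneous d) (hω : ContDiff ℝ 1 ω)
    (hωs : HasCompactSupport ω) :
    ∃ C : ℝ, 0 < C ∧ ∀ (P β : ℝ) (q a : ℕ), 1 ≤ P → q ≠ 0 → (q : ℝ) ≤ P →
      ‖expSum n F ω (a / q + β) P - ((q : ℂ) ^ n)⁻¹ * gaussSumF n F q a *
        ((P ^ n : ℝ) * singInt n F ω (P ^ d * β))‖ ≤
        C * P ^ n * ((q / P) * (1 + P ^ d * |β|)) := by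
  obtain ⟨L, hL0, hL⟩ := exists_norm_mul_eC_sub_le hω hωs
    (contDiff_eval_real (map (Int.castRingHom ℝ) F))
  obtain ⟨ρ, hρ0, hρ⟩ := hωs.isCompact.isBounded.exists_pos_norm_le
  refine ⟨(2 * ρ + 5) ^ n * L, by positivity, fun P β q a hP hq hqP => ?_⟩
  have : NeZero q := ⟨hq⟩
  have hP0 : 0 < P := one_pos.trans_le hP
  set γ := P ^ d * β with hγ
  have hγa : |γ| = P ^ d * |β| := by rw [hγ, abs_mul, abs_of_pos (by positivity)]
  have h := norm_tsum_sub_integral_le (q := q) (P := P) (ρ := ρ) (Λ := L * (1 + |γ|))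
    (χ := fun y => (ZMod.stdAddChar (N := q)).mulShift a
      (eval y (map (Int.castRingHom (ZMod q)) F)))
    (G := fun u => (ω u : ℂ) * eC (γ * eval u (map (Int.castRingHom ℝ) F)))
    (fun _ => (AddChar.norm_apply _ _).le) (by positivity) (hL γ) hρ0.le
    (fun u hu => by
      rw [image_eq_zero_of_notMem_tsupport fun h => hu.not_ge (hρ u h), Complex.ofReal_zero,
        zero_mul]) hP hqP
  convert h using 1
  · congr 2
    · refine tsum_congr fun x => ?_
      have hsc : (eval x F : ℝ) =
          P ^ d * eval (fun i => (x i : ℝ) / P) (map (Int.castRingHom ℝ) F) := by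
        rw [← eval_mul_of_isHomogeneous (hF.map _), ← eval_intCast_comp]
        congr! 3
        field_simp
      rw [← eC_mul_eval_div, mul_left_comm, ← eC_add]
      congr 2
      rw [hγ, mul_right_comm, ← hsc]
      ring
    · have hT : complSum ((ZMod.stdAddChar (N := q)).mulShift a) (map (Int.castRingHom (ZMod q)) F) =
          ∑ y, (ZMod.stdAddChar (N := q)).mulShift a
            (eval y (map (Int.castRingHom (ZMod q)) F)) := by
        rw [complSum]
        congr!
      rw [gaussSumF_eq_complSum, hT, singInt]
      push_cast
      rw [div_pow]
      ring
  · rw [hγa, mul_pow]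
    ring

end MajorArcApproximation

section Arcs

/-- The points within `r` modulo `1` of some rational number with denominator at most `Q`. -/
def arcs (Q r : ℝ) : Set ℝ :=
  {α | ∃ q : ℕ, 0 < q ∧ (q : ℝ) ≤ Q ∧ ∃ a : ℕ, a ≤ q ∧ Nat.gcd a q = 1 ∧ nint (α - (a : ℝ) / q) ≤ r}

/-- The pairs `⟨q, a⟩` with `1 ≤ a ≤ q ≤ Q` and `a` coprime to `q`. -/
def fareyPairs (Q : ℝ) : Finset (Σ _ : ℕ, ℕ) :=
  (Finset.Icc 1 ⌊Q⌋₊).sigma fun q => (Finset.Icc 1 q).filter fun a => Nat.gcd a q = 1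

variable {Q r : ℝ}

theorem mem_fareyPairs {p : Σ _ : ℕ, ℕ} :
    p ∈ fareyPairs Q ↔
      0 < p.1 ∧ (p.1 : ℝ) ≤ Q ∧ 0 < p.2 ∧ p.2 ≤ p.1 ∧ Nat.gcd p.2 p.1 = 1 := by
  simp only [fareyPairs, Finset.mem_sigma, Finset.mem_Icc, Finset.mem_filter,
    Nat.succ_le_iff, and_congr_right_iff, ← and_assoc, and_congr_left_iff]
  rintro - - - h
  simp [Nat.le_floor_iff' h.ne']

theorem nint_add_one (x : ℝ) : nint (x + 1) = nint x := by
  rw [nint, nint, round_add_one]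
  push_cast
  congr 1
  ring

theorem measurable_nint : Measurable nint := by
  have h (x : ℝ) : nint x = |x - (⌊x + 1 / 2⌋ : ℤ)| := by rw [nint, round_eq]
  rw [_root_.funext h]
  fun_prop

theorem measurableSet_arcs (Q r : ℝ) : MeasurableSet (arcs Q r) := by
  have h : arcs Q r = ⋃ (q : ℕ) (_ : 0 < q ∧ (q : ℝ) ≤ Q) (a : ℕ) (_ : a ≤ q ∧ Nat.gcd a q = 1),
      (fun α : ℝ => nint (α - a / q)) ⁻¹' Set.Iic r := by
    ext α
    simp only [arcs, Set.mem_ofPred_eq, Set.mem_iUnion, exists_prop, Set.mem_preimage, Set.mem_Iic,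
      and_assoc]
  rw [h]
  exact MeasurableSet.iUnion fun q => MeasurableSet.iUnion fun _ => MeasurableSet.iUnion fun a =>
    MeasurableSet.iUnion fun _ => (measurable_nint.comp (measurable_id.sub_const _)) measurableSet_Iic

theorem arcs_inter_Ioc (hQ : 1 ≤ Q) (hr : 0 ≤ r) (hrQ : 2 * r * Q ^ 2 < 1) :
    arcs Q r ∩ Set.Ioc (1 / (2 * Q)) (1 / (2 * Q) + 1) =
      ⋃ p ∈ fareyPairs Q, Set.Icc ((p.2 : ℝ) / p.1 - r) (p.2 / p.1 + r) := by
  have hc : r < 1 / (2 * Q) := by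
    rw [lt_div_iff₀ (by positivity)]
    nlinarith [mul_nonneg hr (mul_nonneg (zero_le_one.trans hQ) (sub_nonneg.2 hQ))]
  set c := 1 / (2 * Q) with hcdef
  have hc2 (q : ℕ) (hq : 0 < q) (hqQ : (q : ℝ) ≤ Q) : 2 * c ≤ 1 / q := by
    have hq' : (0 : ℝ) < q := by exact_mod_cast hq
    calc 2 * c = 1 / Q := by rw [hcdef]; field_simp
      _ ≤ 1 / q := by gcongr
  ext α
  simp only [Set.mem_inter_iff, Set.mem_Ioc, Set.mem_iUnion, Set.mem_Icc, exists_prop,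
    mem_fareyPairs, Sigma.exists]
  constructor
  · rintro ⟨⟨q, hq, hqQ, a, -, haq, hα⟩, h1, h2⟩
    have hq' : (0 : ℝ) < q := by exact_mod_cast hq
    have := hc2 q hq hqQ
    set k := round (α - (a : ℝ) / q)
    rw [nint, abs_le] at hα
    have hb : ((a + k * q : ℤ) : ℝ) / q = a / q + k := by
      push_cast
      field_simp
    have hb0 : 0 < (a + k * q : ℤ) := by
      have : 0 < ((a + k * q : ℤ) : ℝ) / q := by rw [hb]; linarith
      exact_mod_cast (div_pos_iff_of_pos_right hq').1 this
    have hb1 : (a + k * q : ℤ) < q + 1 := by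
      have : ((a + k * q : ℤ) : ℝ) / q < 1 + 1 / q := by rw [hb]; linarith
      rw [div_lt_iff₀ hq', add_mul, one_div_mul_cancel hq'.ne', one_mul] at this
      exact_mod_cast this
    obtain ⟨b, hbk⟩ := Int.eq_ofNat_of_zero_le hb0.le
    have hbr : (b : ℝ) / q = a / q + k := by
      rw [← hb, hbk]
      simp
    refine ⟨q, b, ⟨hq, hqQ, by omega, by omega, ?_⟩, ?_, ?_⟩
    · have h : Int.gcd (a + k * q) q = Int.gcd a q := Int.gcd_add_mul_right_left _ _ _
      rw [hbk] at h
      exact_mod_cast h.trans haq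
    · rw [hbr]
      linarith
    · rw [hbr]
      linarith
  · rintro ⟨q, a, ⟨hq, hqQ, ha, haq, hg⟩, h1, h2⟩
    have hq' : (0 : ℝ) < q := by exact_mod_cast hq
    have h3 : 1 / (q : ℝ) ≤ a / q := by
      gcongr
      exact_mod_cast ha
    have h4 : (a : ℝ) / q ≤ 1 := by
      rw [div_le_one hq']
      exact_mod_cast haq
    have := hc2 q hq hqQ
    refine ⟨⟨q, hq, hqQ, a, haq, hg, ?_⟩, by linarith, by linarith⟩
    refine (round_le _ 0).trans ?_
    rw [Int.cast_zero, sub_zero, abs_le]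
    constructor <;> linarith

theorem pairwise_disjoint_Icc_fareyPairs (hrQ : 2 * r * Q ^ 2 < 1) :
    (↑(fareyPairs Q) : Set (Σ _ : ℕ, ℕ)).Pairwise (Function.onFun Disjoint
      fun p => Set.Icc ((p.2 : ℝ) / p.1 - r) (p.2 / p.1 + r)) := by
  rintro ⟨q, a⟩ hp ⟨q', a'⟩ hp' hne
  rw [Finset.mem_coe, mem_fareyPairs] at hp hp'
  obtain ⟨hq, hqQ, ha, haq, hg⟩ := hp
  obtain ⟨hq', hqQ', ha', haq', hg'⟩ := hp'
  simp only at *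
  have h0 : (0 : ℝ) < q := by exact_mod_cast hq
  have h0' : (0 : ℝ) < q' := by exact_mod_cast hq'
  rw [Function.onFun, Set.disjoint_left]
  rintro α ⟨h1, h2⟩ ⟨h3, h4⟩
  simp only at h1 h2 h3 h4
  have hcross : a * q' ≠ a' * q := by
    intro h
    have hd : q = q' := Nat.dvd_antisymm
      (Nat.Coprime.dvd_of_dvd_mul_left (Nat.Coprime.symm hg) ⟨a', by rw [h, mul_comm]⟩)
      (Nat.Coprime.dvd_of_dvd_mul_left (Nat.Coprime.symm hg') ⟨a, by rw [← h, mul_comm]⟩)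
    subst hd
    exact hne (by rw [Nat.eq_of_mul_eq_mul_right hq h])
  have h5 : (1 : ℝ) ≤ |(a : ℝ) * q' - a' * q| := by
    have : (a * q' - a' * q : ℤ) ≠ 0 := by
      rw [sub_ne_zero]
      exact_mod_cast hcross
    exact_mod_cast Int.one_le_abs this
  have h6 : |(a : ℝ) / q - a' / q'| ≤ 2 * r := by
    rw [abs_le]
    constructor <;> linarith
  have h7 : |(a : ℝ) / q - a' / q'| = |(a : ℝ) * q' - a' * q| / (q * q') := by
    rw [div_sub_div _ _ h0.ne' h0'.ne', abs_div, abs_of_pos (mul_pos h0 h0'), mul_comm (q : ℝ) a']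
  have hr : 0 ≤ 2 * r := (abs_nonneg _).trans h6
  rw [h7, div_le_iff₀ (by positivity)] at h6
  have h8 : 2 * r * (q * q') ≤ 2 * r * Q ^ 2 := by
    rw [sq]
    have := h0.le.trans hqQ
    gcongr
  linarith

theorem setIntegral_arcs {S : ℝ → ℂ} (hS : Continuous S) (hSp : Function.Periodic S 1) (hQ : 1 ≤ Q)
    (hr : 0 ≤ r) (hrQ : 2 * r * Q ^ 2 < 1) :
    ∫ α in arcs Q r ∩ Set.Ico 0 1, S α =
      ∑ p ∈ fareyPairs Q, ∫ β in -r..r, S ((p.2 : ℝ) / p.1 + β) := by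
  have hm := measurableSet_arcs Q r
  have hper : Function.Periodic ((arcs Q r).indicator S) 1 := by
    intro α
    have h : α + 1 ∈ arcs Q r ↔ α ∈ arcs Q r := by
      simp only [arcs, Set.mem_ofPred_eq, add_sub_right_comm, nint_add_one]
    by_cases hα : α ∈ arcs Q r
    · rw [Set.indicator_of_mem hα, Set.indicator_of_mem (h.2 hα), hSp]
    · rw [Set.indicator_of_notMem hα, Set.indicator_of_notMem (h.not.2 hα)]
  rw [Set.inter_comm, ← setIntegral_indicator hm, integral_Ico_eq_integral_Ioo,
    ← integral_Ioc_eq_integral_Ioo, ← intervalIntegral.integral_of_le zero_le_one]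
  have h := hper.intervalIntegral_add_eq 0 (1 / (2 * Q))
  rw [zero_add] at h
  rw [h, intervalIntegral.integral_of_le (by simp), setIntegral_indicator hm, Set.inter_comm,
    arcs_inter_Ioc hQ hr hrQ, integral_biUnion_finset _ (fun _ _ => measurableSet_Icc)
      (pairwise_disjoint_Icc_fareyPairs hrQ) fun _ _ => hS.integrableOn_Icc]
  refine Finset.sum_congr rfl fun p _ => ?_
  rw [intervalIntegral.integral_comp_add_left, ← sub_eq_add_neg,
    intervalIntegral.integral_of_le (by linarith), integral_Icc_eq_integral_Ioc]

end Arcs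

section Assembly

variable {n d : ℕ} {F : MvPolynomial (Fin n) ℤ} {ω : (Fin n → ℝ) → ℝ} {Q : ℝ}

theorem finite_support_weight (hωs : HasCompactSupport ω) {P : ℝ} (hP : 0 < P) :
    {x : Fin n → ℤ | ω (fun i => (x i : ℝ) / P) ≠ 0}.Finite := by
  obtain ⟨ρ, -, hρ⟩ := hωs.isCompact.isBounded.exists_pos_norm_le
  refine (Set.finite_Icc (fun _ => -⌈ρ * P⌉) fun _ => ⌈ρ * P⌉).subset fun x hx => ?_
  have h (i : Fin n) : |(x i : ℝ)| ≤ ⌈ρ * P⌉ := by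
    have h1 := (norm_le_pi_norm (fun i => (x i : ℝ) / P) i).trans (hρ _ (subset_tsupport _ hx))
    rw [norm_div, Real.norm_eq_abs, Real.norm_of_nonneg hP.le, div_le_iff₀ hP] at h1
    exact h1.trans (Int.le_ceil _)
  exact ⟨fun i => by exact_mod_cast (abs_le.1 (h i)).1, fun i => by exact_mod_cast (abs_le.1 (h i)).2⟩

theorem continuous_expSum (F : MvPolynomial (Fin n) ℤ) (hωs : HasCompactSupport ω) {P : ℝ}
    (hP : 0 < P) : Continuous fun α => expSum n F ω α P := by
  have h (α : ℝ) : expSum n F ω α P = ∑ x ∈ (finite_support_weight hωs hP).toFinset,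
      (ω (fun i => (x i : ℝ) / P) : ℂ) * eC (α * (eval x F : ℝ)) :=
    tsum_eq_sum fun x hx => by
      rw [Set.Finite.mem_toFinset, Set.mem_ofPred_eq, not_not] at hx
      simp [hx]
  simp only [h]
  exact continuous_finsetSum _ fun x _ =>
    continuous_const.mul (contDiff_eC.continuous.comp (continuous_id.mul continuous_const))

theorem periodic_expSum (F : MvPolynomial (Fin n) ℤ) (ω : (Fin n → ℝ) → ℝ) (P : ℝ) :
    Function.Periodic (fun α => expSum n F ω α P) 1 := by
  intro α
  refine tsum_congr fun x => ?_
  rw [add_mul, one_mul, eC_add, eC_intCast, mul_one]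

theorem card_fareyPairs_le (hQ : 0 ≤ Q) : ((fareyPairs Q).card : ℝ) ≤ Q ^ 2 := by
  have h : (fareyPairs Q).card ≤ ⌊Q⌋₊ * ⌊Q⌋₊ := by
    rw [fareyPairs, Finset.card_sigma]
    refine (Finset.sum_le_card_nsmul _ _ ⌊Q⌋₊ fun q hq => ?_).trans (by simp)
    refine (Finset.card_filter_le _ _).trans ?_
    simpa using (Finset.mem_Icc.1 hq).2
  calc ((fareyPairs Q).card : ℝ) ≤ (⌊Q⌋₊ : ℝ) * ⌊Q⌋₊ := by exact_mod_cast h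
    _ ≤ Q ^ 2 := by
      rw [sq]
      gcongr <;> exact Nat.floor_le hQ

theorem sum_fareyPairs_mul (F : MvPolynomial (Fin n) ℤ) (Q : ℝ) (X : ℂ) :
    ∑ p ∈ fareyPairs Q, ((p.1 : ℂ) ^ n)⁻¹ * gaussSumF n F p.1 p.2 * X =
      (∑ q ∈ Finset.Icc 1 ⌊Q⌋₊, seriesTerm n F q) * X := by
  rw [← Finset.sum_mul, fareyPairs, Finset.sum_sigma]
  congr 1
  refine Finset.sum_congr rfl fun q hq => ?_
  rw [seriesTerm, if_neg (Nat.one_le_iff_ne_zero.1 (Finset.mem_Icc.1 hq).1), Finset.mul_sum]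

theorem norm_setIntegral_arcs_sub_le {C P : ℝ} (hC : 0 ≤ C)
    (hS : ∀ (β : ℝ) (q a : ℕ), q ≠ 0 → (q : ℝ) ≤ P →
      ‖expSum n F ω (a / q + β) P - ((q : ℂ) ^ n)⁻¹ * gaussSumF n F q a *
        ((P ^ n : ℝ) * singInt n F ω (P ^ d * β))‖ ≤ C * P ^ n * ((q / P) * (1 + P ^ d * |β|)))
    (hωs : HasCompactSupport ω) (hI : Continuous (singInt n F ω)) (hQ : 1 ≤ Q) (hQP : Q ≤ P)
    (hd : 2 * Q ^ 3 < P ^ d) :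
    ‖(∫ α in arcs Q (Q / P ^ d) ∩ Set.Ico 0 1, expSum n F ω α P) -
      (∑ q ∈ Finset.Icc 1 ⌊Q⌋₊, seriesTerm n F q) *
        ((P ^ n / P ^ d : ℝ) * ∫ γ in -Q..Q, singInt n F ω γ)‖ ≤
      4 * C * (P ^ n / P ^ d) * (Q ^ 5 / P) := by
  have hP : 0 < P := by linarith
  have hQ0 : 0 < Q := by linarith
  set r := Q / P ^ d with hr
  have hr0 : 0 < r := by positivity
  have hrP : P ^ d * r = Q := by rw [hr]; field_simp
  have hrQ : 2 * r * Q ^ 2 < 1 := by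
    have : 2 * r * Q ^ 2 = 2 * Q ^ 3 / P ^ d := by rw [hr]; ring
    rwa [this, div_lt_one (by positivity)]
  have hcomp : ∫ β in -r..r, ((P ^ n : ℝ) : ℂ) * singInt n F ω (P ^ d * β) =
      (P ^ n / P ^ d : ℝ) * ∫ γ in -Q..Q, singInt n F ω γ := by
    rw [intervalIntegral.integral_const_mul,
      intervalIntegral.integral_comp_mul_left _ (pow_pos hP d).ne', mul_neg, hrP,
      Complex.real_smul, ← mul_assoc, ← Complex.ofReal_mul, div_eq_mul_inv]
  have hSc := continuous_expSum F hωs hP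
  rw [setIntegral_arcs hSc (periodic_expSum F ω P) hQ hr0.le hrQ, ← sum_fareyPairs_mul,
    ← Finset.sum_sub_distrib]
  have hterm : ∀ p ∈ fareyPairs Q, ‖(∫ β in -r..r, expSum n F ω (p.2 / p.1 + β) P) -
      ((p.1 : ℂ) ^ n)⁻¹ * gaussSumF n F p.1 p.2 *
        ((P ^ n / P ^ d : ℝ) * ∫ γ in -Q..Q, singInt n F ω γ)‖ ≤
      C * P ^ n * ((Q / P) * (1 + Q)) * (2 * r) := by
    intro p hp
    obtain ⟨hq, hqQ, -⟩ := mem_fareyPairs.1 hp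
    rw [← hcomp, ← intervalIntegral.integral_const_mul, ← intervalIntegral.integral_sub]
    · refine (intervalIntegral.norm_integral_le_of_norm_le_const
        (C := C * P ^ n * ((Q / P) * (1 + Q))) fun β hβ => ?_).trans_eq ?_
      · have hβ' : |β| ≤ r := by
          rw [Set.uIoc_of_le (by linarith)] at hβ
          exact abs_le.2 ⟨hβ.1.le, hβ.2⟩
        refine (hS β p.1 p.2 hq.ne' (hqQ.trans hQP)).trans ?_
        gcongr
        calc P ^ d * |β| ≤ P ^ d * r := by gcongr
          _ = Q := hrP
      · rw [sub_neg_eq_add, ← two_mul, abs_of_pos (by positivity)]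
    · exact (hSc.comp (continuous_const.add continuous_id)).intervalIntegrable _ _
    · exact (continuous_const.mul (continuous_const.mul
        (hI.comp (continuous_const.mul continuous_id)))).intervalIntegrable _ _
  refine (norm_sum_le_of_le _ hterm).trans ?_
  rw [Finset.sum_const, nsmul_eq_mul]
  calc ((fareyPairs Q).card : ℝ) * (C * P ^ n * ((Q / P) * (1 + Q)) * (2 * r))
      ≤ Q ^ 2 * (C * P ^ n * ((Q / P) * (Q + Q)) * (2 * r)) := by
        gcongr
        exact card_fareyPairs_le hQ0.le
    _ = 4 * C * (P ^ n / P ^ d) * (Q ^ 5 / P) := by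
        rw [hr]
        field_simp
        ring

theorem norm_tsum_sub_sum_Icc_floor_le {A : ℕ → ℂ} {η : ℝ} (hη : 0 ≤ η) (hQ : 0 < Q)
    (hA0 : A 0 = 0) (hA : Summable fun q => ‖A q‖)
    (hAη : Summable fun q : ℕ => (q : ℝ) ^ η * ‖A q‖) :
    ‖∑ q ∈ Finset.Icc 1 ⌊Q⌋₊, A q - ∑' q, A q‖ ≤ Q ^ (-η) * ∑' q : ℕ, (q : ℝ) ^ η * ‖A q‖ := by
  rw [← hA.of_norm.sum_add_tsum_compl (s := Finset.Icc 1 ⌊Q⌋₊), sub_add_cancel_left, norm_neg]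
  set s : Set ℕ := (↑(Finset.Icc 1 ⌊Q⌋₊))ᶜ with hs
  have hle (q : s) : ‖A q‖ ≤ Q ^ (-η) * ((q : ℝ) ^ η * ‖A q‖) := by
    obtain ⟨q, hq⟩ := q
    rcases Nat.eq_zero_or_pos q with rfl | hq0
    · simp [hA0]
    · rw [hs, Set.mem_compl_iff, Finset.mem_coe, Finset.mem_Icc, not_and, not_le] at hq
      have hqQ : Q < q := (Nat.floor_lt hQ.le).1 (hq hq0)
      rw [← mul_assoc, Real.rpow_neg hQ.le, ← div_eq_inv_mul]
      refine le_mul_of_one_le_left (norm_nonneg _) ?_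
      rw [one_le_div (by positivity)]
      gcongr
  calc ‖∑' q : s, A q‖ ≤ ∑' q : s, ‖A q‖ := norm_tsum_le_tsum_norm (hA.subtype s)
    _ ≤ ∑' q : s, Q ^ (-η) * ((q : ℝ) ^ η * ‖A q‖) :=
        (hA.subtype s).tsum_le_tsum hle ((hAη.subtype s).mul_left _)
    _ = Q ^ (-η) * ∑' q : s, ((q : ℝ) ^ η * ‖A q‖) := tsum_mul_left
    _ ≤ _ := by
        gcongr
        exact hAη.tsum_subtype_le _ s fun q => by positivity

theorem norm_intervalIntegral_sub_integral_le {I : ℝ → ℂ} {s : ℝ} (hs : 0 ≤ s) (hQ : 0 < Q)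
    (hI : Integrable I) (hIs : Integrable fun γ => |γ| ^ s * ‖I γ‖) :
    ‖(∫ γ in -Q..Q, I γ) - ∫ γ, I γ‖ ≤ Q ^ (-s) * ∫ γ, |γ| ^ s * ‖I γ‖ := by
  rw [intervalIntegral.integral_of_le (by linarith), ← integral_add_compl measurableSet_Ioc hI,
    sub_add_cancel_left, norm_neg, ← integral_indicator measurableSet_Ioc.compl,
    ← integral_const_mul]
  refine norm_integral_le_of_norm_le (hIs.const_mul _) (Filter.Eventually.of_forall fun γ => ?_)
  by_cases h : γ ∈ (Set.Ioc (-Q) Q)ᶜ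
  · rw [Set.indicator_of_mem h, ← mul_assoc, Real.rpow_neg hQ.le, ← div_eq_inv_mul]
    refine le_mul_of_one_le_left (norm_nonneg _) ?_
    rw [one_le_div (by positivity)]
    gcongr
    by_contra hlt
    exact h ⟨(abs_lt.1 (not_le.1 hlt)).1, (abs_lt.1 (not_le.1 hlt)).2.le⟩
  · rw [Set.indicator_of_notMem h, norm_zero]
    positivity

end Assembly

section MainTerm

variable {n d : ℕ} {F : MvPolynomial (Fin n) ℤ} {ω : (Fin n → ℝ) → ℝ}

theorem exists_norm_setIntegral_majorArcs_sub_le (hd : 3 ≤ d) (hF : F.IsHomogeneous d)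
    (hω : ContDiff ℝ 1 ω) (hωs : HasCompactSupport ω) {η s : ℝ} (hη : 0 < η) (hs : 0 < s)
    (hA : Summable fun q : ℕ => ‖seriesTerm n F q‖)
    (hAη : Summable fun q : ℕ => (q : ℝ) ^ η * ‖seriesTerm n F q‖)
    (hI : Integrable (singInt n F ω))
    (hIs : Integrable fun γ => |γ| ^ s * ‖singInt n F ω γ‖) :
    ∃ δ' C : ℝ, 0 < δ' ∧ 0 < C ∧ ∀ P : ℝ, 2 ≤ P →
      ‖(∫ α in majorArcs d (1 / 6) P ∩ Set.Ico (0 : ℝ) 1, expSum n F ω α P) -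
          (∑' q : ℕ, seriesTerm n F q) * (∫ γ : ℝ, singInt n F ω γ) *
            ((P ^ ((n : ℝ) - d) : ℝ) : ℂ)‖ ≤ C * P ^ ((n : ℝ) - d - δ') := by
  obtain ⟨C₀, hC₀, hS⟩ := exists_norm_expSum_sub_le hF hω hωs
  set A := seriesTerm n F
  set I := singInt n F ω
  set T := ∑' q : ℕ, (q : ℝ) ^ η * ‖A q‖
  set J := ∫ γ, |γ| ^ s * ‖I γ‖
  have hT : 0 ≤ T := tsum_nonneg fun q => by positivity
  have hJ : 0 ≤ J := integral_nonneg fun γ => by positivity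
  have hI0 : 0 ≤ ∫ γ, ‖I γ‖ := integral_nonneg fun γ => norm_nonneg _
  have hIc : Continuous I := continuous_singInt F hω.continuous hωs
  refine ⟨1 / 6 * min 1 (min η s), 4 * C₀ + (T * (∫ γ, ‖I γ‖) + ‖∑' q, A q‖ * J), by positivity,
    by positivity, fun P hP => ?_⟩
  set δ' := 1 / 6 * min 1 (min η s) with hδ'
  have hP0 : 0 < P := by linarith
  have hP1 : 1 ≤ P := by linarith
  set Q := P ^ (1 / 6 : ℝ) with hQdef
  have hQ1 : 1 ≤ Q := Real.one_le_rpow hP1 (by norm_num)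
  have hQ0 : 0 < Q := by linarith
  have hQ6 : Q ^ 6 = P := by
    rw [hQdef, ← Real.rpow_natCast, ← Real.rpow_mul hP0.le]
    norm_num
  have hQpow (t : ℝ) (ht : min 1 (min η s) ≤ t) : Q ^ (-t) ≤ P ^ (-δ') := by
    rw [hQdef, ← Real.rpow_mul hP0.le]
    refine Real.rpow_le_rpow_of_exponent_le hP1 ?_
    rw [hδ']
    linarith
  have hQP : Q ≤ P := by
    rw [← hQ6]
    exact le_self_pow₀ hQ1 (by norm_num)
  have hdP : 2 * Q ^ 3 < P ^ d := by
    have h1 : P * P ^ 2 ≤ P ^ d := by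
      rw [← pow_succ']
      exact pow_le_pow_right₀ hP1 hd
    have h2 : Q ^ 3 ≤ P := by
      rw [← hQ6]
      exact pow_le_pow_right₀ hQ1 (by norm_num)
    nlinarith
  have hmaj : majorArcs d (1 / 6) P = arcs Q (Q / P ^ d) := by
    rw [majorArcs, arcs, Real.rpow_sub hP0, Real.rpow_natCast]
  have hscale : P ^ ((n : ℝ) - d) = P ^ n / P ^ d := by
    rw [Real.rpow_sub hP0, Real.rpow_natCast, Real.rpow_natCast]
  have h1 := norm_setIntegral_arcs_sub_le hC₀.le (fun β q a hq hqP => hS P β q a hP1 hq hqP)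
    hωs hIc hQ1 hQP hdP
  have h2 := norm_tsum_sub_sum_Icc_floor_le hη.le hQ0 (A := A) (by simp [A, seriesTerm]) hA hAη
  have h3 := norm_intervalIntegral_sub_integral_le hs.le hQ0 hI hIs
  have h4 : ‖∫ γ in -Q..Q, I γ‖ ≤ ∫ γ, ‖I γ‖ := by
    rw [intervalIntegral.integral_of_le (by linarith)]
    exact (norm_integral_le_integral_norm _).trans
      (setIntegral_le_integral hI.norm (Filter.Eventually.of_forall fun γ => norm_nonneg _))
  have h5 : Q ^ 5 / P ≤ P ^ (-δ') := by
    refine le_trans (le_of_eq ?_) (hQpow 1 (min_le_left _ _))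
    rw [Real.rpow_neg_one, ← hQ6]
    field_simp
  rw [hmaj, hscale, sub_eq_add_neg _ δ', Real.rpow_add hP0, hscale]
  set X := P ^ n / P ^ d with hX
  have hX0 : 0 < X := by positivity
  set D := P ^ (-δ')
  set A₁ := ∑ q ∈ Finset.Icc 1 ⌊Q⌋₊, A q
  set I₁ := ∫ γ in -Q..Q, I γ
  set M := ∫ α in arcs Q (Q / P ^ d) ∩ Set.Ico 0 1, expSum n F ω α P
  have h6 : M - (∑' q, A q) * (∫ γ, I γ) * X = (M - A₁ * (X * I₁)) +
      X * ((A₁ - ∑' q, A q) * I₁ + (∑' q, A q) * (I₁ - ∫ γ, I γ)) := by ring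
  have h7 : ‖(X : ℂ) * ((A₁ - ∑' q, A q) * I₁ + (∑' q, A q) * (I₁ - ∫ γ, I γ))‖ ≤
      X * (D * T * (∫ γ, ‖I γ‖) + ‖∑' q, A q‖ * (D * J)) := by
    rw [norm_mul, Complex.norm_real, Real.norm_of_nonneg hX0.le]
    gcongr
    refine (norm_add_le _ _).trans ?_
    rw [norm_mul, norm_mul]
    gcongr
    · exact h2.trans (by gcongr; exact hQpow η ((min_le_right _ _).trans (min_le_left _ _)))
    · exact h3.trans (by gcongr; exact hQpow s ((min_le_right _ _).trans (min_le_right _ _)))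
  rw [h6]
  calc _ ≤ 4 * C₀ * X * D + X * (D * T * (∫ γ, ‖I γ‖) + ‖∑' q, A q‖ * (D * J)) :=
        (norm_add_le _ _).trans (add_le_add (h1.trans (by gcongr)) h7)
    _ = _ := by ring

end MainTerm

/-- The major arc asymptotic (Lemma `lem:major`). -/
theorem major_arc_asymptotic (n d : ℕ) (hd : 3 ≤ d)
    (F : MvPolynomial (Fin n) ℤ) (hF : F.IsHomogeneous d)
    (σ : ℕ)
    (hσ : singDim n ℚ (MvPolynomial.map (Int.castRingHom ℚ) F) = (σ : WithBot (WithTop ℕ)))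
    (hn : (3 : ℝ) / 4 * ((d : ℝ) - 1) * 2 ^ d < (n : ℝ) - (σ : ℝ))
    (x₀ : Fin n → ℝ)
    (hx₀ : MvPolynomial.eval x₀ (MvPolynomial.map (Int.castRingHom ℝ) F) = 0)
    (hx₀' : ∃ i,
      MvPolynomial.eval x₀ (MvPolynomial.pderiv i (MvPolynomial.map (Int.castRingHom ℝ) F)) ≠ 0) :
    ∃ δ₀ : ℝ, 0 < δ₀ ∧ δ₀ ≤ 1 ∧
      ∀ δ : ℝ, 0 < δ → δ ≤ δ₀ →
        Summable (fun q : ℕ => ‖seriesTerm n F q‖) ∧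
        MeasureTheory.Integrable (singInt n F (omegaMaj n x₀ δ)) ∧
        ∃ δ' C : ℝ, 0 < δ' ∧ 0 < C ∧
          ∀ P : ℝ, 2 ≤ P →
            ‖(∫ α in majorArcs d (1 / 6) P ∩ Set.Ico (0 : ℝ) 1,
                  expSum n F (omegaMaj n x₀ δ) α P) -
                (∑' q : ℕ, seriesTerm n F q) * (∫ γ : ℝ, singInt n F (omegaMaj n x₀ δ) γ) *
                  ((P ^ ((n : ℝ) - d) : ℝ) : ℂ)‖ ≤
              C * P ^ ((n : ℝ) - d - δ') := by
  obtain ⟨m, rfl⟩ : ∃ m, d = m + 2 := ⟨d - 2, by omega⟩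
  have hm : 1 ≤ m := by omega
  obtain ⟨i, hi⟩ := hx₀'
  obtain ⟨δ₀, hδ₀, hδ₀1, hball⟩ := exists_closedBall_ne_zero _ hi
  have hn' : (3 : ℝ) / 2 * (m + 1) < ((n : ℝ) - σ) / 2 ^ (m + 1) := by
    rw [lt_div_iff₀ (by positivity)]
    refine lt_of_eq_of_lt ?_ hn
    push_cast
    ring
  obtain ⟨η, hη, hAη⟩ := exists_summable_seriesTerm hF hσ.le hm hn'
  have hA : Summable fun q : ℕ => ‖seriesTerm n F q‖ := by
    refine hAη.of_nonneg_of_le (fun _ => norm_nonneg _) fun q => ?_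
    rcases Nat.eq_zero_or_pos q with rfl | hq
    · simp [seriesTerm]
    · exact le_mul_of_one_le_left (norm_nonneg _)
        (Real.one_le_rpow (by exact_mod_cast hq) hη.le)
  refine ⟨δ₀, hδ₀, hδ₀1, fun δ hδ hδle => ?_⟩
  have hω := contDiff_omegaMaj x₀ δ
  have hωs := hasCompactSupport_omegaMaj x₀ hδ
  have hIc := continuous_singInt F hω.continuous hωs
  obtain ⟨C, -, hC⟩ := exists_norm_singInt_le F hω hωs i fun x hx =>
    hball x (Metric.closedBall_subset_closedBall hδle (tsupport_omegaMaj_subset x₀ hδ hx))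
  have hI : Integrable (singInt n F (omegaMaj n x₀ δ)) := by
    refine (integrable_norm_iff hIc.aestronglyMeasurable).1 ?_
    simpa using integrable_rpow_mul_norm_singInt hIc hC le_rfl one_pos
  exact ⟨hA, hI, exists_norm_setIntegral_majorArcs_sub_le hd hF (hω.of_le (by simp)) hωs hη
    one_half_pos hA hAη hI
    (integrable_rpow_mul_norm_singInt hIc hC one_half_pos.le one_half_lt_one)⟩

end
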